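/- arXiv:math/0606270 — 9 statements merged into one kernel-verified Lean document; each statement's English description precedes it below -/
import Mathlib

section
/- If ℱ ⊆ [ℕ]^ω is a centered family with no pseudo-intersection that is closed under intersections of finite subfamilies, then for every partition of ℱ into finitely many pieces ℱ = ℱ₁ ∪ … ∪ ℱ_k, there is some n ≤ k such that ℱₙ has no pseudo-intersection. -/
open Set Topology Filter

/-- The Pytkeev property of a topological space. -/
def PytkeevProp (Y : Type*) [TopologicalSpace Y] : Prop :=
  ∀ A : Set Y, ∀ y : Y, y ∈ closure A \ A →
    ∃ 𝒜 : ℕ → Set Y, (∀ n, (𝒜 n).Infinite ∧ 𝒜 n ⊆ A) ∧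
      ∀ U ∈ nhds y, ∃ n, 𝒜 n ⊆ U

/-- Countable tightness. -/
def CountableTightness (Y : Type*) [TopologicalSpace Y] : Prop :=
  ∀ A : Set Y, ∀ y ∈ closure A, ∃ B ⊆ A, B.Countable ∧ y ∈ closure B

/-- The Reznichenko property (weakly Fréchet-Urysohn). -/
def ReznichenkoProp (Y : Type*) [TopologicalSpace Y] : Prop :=
  ∀ A : Set Y, ∀ y : Y, y ∈ closure A \ A →
    ∃ F : ℕ → Set Y, (∀ n, F n ⊆ A ∧ (F n).Finite) ∧
      (∀ m n, m ≠ n → Disjoint (F m) (F n)) ∧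
      ∀ U ∈ nhds y, ∀ᶠ n in Filter.atTop, (F n ∩ U).Nonempty

/-- `C_p(X)`: continuous real-valued functions on `X`, as a subspace of `ℝ^X`
with the product (pointwise convergence) topology. -/
abbrev Cp (X : Type*) [TopologicalSpace X] : Type _ :=
  {f : X → ℝ // Continuous f}

/-- `C_p(X, S)`: continuous functions from `X` to `S ⊆ ℝ`, as a subspace of `ℝ^X`. -/
abbrev CpS (X : Type*) [TopologicalSpace X] (S : Set ℝ) : Type _ :=
  {f : X → ℝ // Continuous f ∧ ∀ x, f x ∈ S}

/-- `A` is a pseudo-intersection of `ℱ`: `A` is infinite and almost contained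
in every member of `ℱ`. -/
def IsPseudoIntersection (A : Set ℕ) (ℱ : Set (Set ℕ)) : Prop :=
  A.Infinite ∧ ∀ B ∈ ℱ, (A \ B).Finite

/-- A centered family in `[ℕ]^ω`: every nonempty finite subfamily has infinite
intersection (in particular all members are infinite). -/
def IsCentered (ℱ : Set (Set ℕ)) : Prop :=
  ∀ 𝒢 ⊆ ℱ, 𝒢.Finite → 𝒢.Nonempty → (⋂₀ 𝒢).Infinite

/-- The pseudo-intersection number 𝔭. -/
noncomputable def pNumber : Cardinal :=
  sInf { c : Cardinal | ∃ ℱ : Set (Set ℕ), IsCentered ℱ ∧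
    (¬ ∃ A, IsPseudoIntersection A ℱ) ∧ Cardinal.mk ℱ = c }

/-- The cardinal 𝔭_σ. -/
noncomputable def pSigmaNumber : Cardinal :=
  sInf { c : Cardinal | ∃ ℱ : Set (Set ℕ), IsCentered ℱ ∧
    (∀ 𝒬 : ℕ → Set (Set ℕ), (⋃ n, 𝒬 n) = ℱ →
      ∃ n, ¬ ∃ A, IsPseudoIntersection A (𝒬 n)) ∧ Cardinal.mk ℱ = c }

/-- A tower: a family in `[ℕ]^ω` linearly ordered by `⊆*` with no
pseudo-intersection. -/
def IsTower (ℱ : Set (Set ℕ)) : Prop :=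
  (∀ A ∈ ℱ, A.Infinite) ∧
  (∀ A ∈ ℱ, ∀ B ∈ ℱ, (A \ B).Finite ∨ (B \ A).Finite) ∧
  ¬ ∃ A, IsPseudoIntersection A ℱ

/-- The tower number 𝔱. -/
noncomputable def tNumber : Cardinal :=
  sInf { c : Cardinal | ∃ ℱ : Set (Set ℕ), IsTower ℱ ∧ Cardinal.mk ℱ = c }

/-- An ω-cover of `X`: `X` itself is not a member, and every finite subset of
`X` is contained in some member. -/
def IsOmegaCover {X : Type*} (𝒰 : Set (Set X)) : Prop :=
  Set.univ ∉ 𝒰 ∧ ∀ F : Set X, F.Finite → ∃ U ∈ 𝒰, F ⊆ U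

/-- `⟨ℱ⟩`: the closure of `ℱ` under intersections of (nonempty) finite subfamilies. -/
def FinInterClosure (ℱ : Set (Set ℕ)) : Set (Set ℕ) :=
  { S | ∃ 𝒢 ⊆ ℱ, 𝒢.Finite ∧ 𝒢.Nonempty ∧ S = ⋂₀ 𝒢 }

/-- A zero-dimensional space: the clopen sets form a base. -/
def ZeroDimensionalSpace (X : Type*) [TopologicalSpace X] : Prop :=
  ∀ x : X, ∀ U ∈ nhds x, ∃ V : Set X, IsClopen V ∧ x ∈ V ∧ V ⊆ U

/-- The set `S₀ = {1/n : n ∈ ℕ} ∪ {0} ⊆ ℝ`. -/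
def Szero : Set ℝ := {x : ℝ | ∃ n : ℕ, x = 1 / (n + 1)} ∪ {0}

/-- An ω-groupable family: it can be partitioned into finite pieces such that
every finite `F ⊆ X` is contained in some member of all but finitely many pieces. -/
def IsOmegaGroupable {X : Type*} (𝒰 : Set (Set X)) : Prop :=
  ∃ 𝒬 : Set (Set (Set X)), (∀ ℱ ∈ 𝒬, ℱ.Finite) ∧
    𝒬.PairwiseDisjoint id ∧ ⋃₀ 𝒬 = 𝒰 ∧
    ∀ F : Set X, F.Finite → { ℱ ∈ 𝒬 | ¬ ∃ U ∈ ℱ, F ⊆ U }.Finite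

/-- if a centered family with no pseudo-intersection is closed
under intersections of nonempty finite subfamilies, then in every finite
partition some piece has no pseudo-intersection. -/
theorem statement1 (ℱ : Set (Set ℕ)) (hcent : IsCentered ℱ)
    (hnpi : ¬ ∃ A, IsPseudoIntersection A ℱ)
    (hclosed : ∀ 𝒢 ⊆ ℱ, 𝒢.Finite → 𝒢.Nonempty → ⋂₀ 𝒢 ∈ ℱ)
    (k : ℕ) (𝒬 : Fin k → Set (Set ℕ)) (hpart : (⋃ i, 𝒬 i) = ℱ) :
    ∃ i : Fin k, ¬ ∃ A, IsPseudoIntersection A (𝒬 i) := by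
  by_contra hcon
  push Not at hcon
  choose A hA using hcon
  have hB : ∀ i, ∃ B ∈ ℱ, ¬ (A i \ B).Finite := by
    intro i
    by_contra hc
    push Not at hc
    exact hnpi ⟨A i, (hA i).1, fun B hB => by simpa using hc B hB⟩
  choose B hBF hBinf using hB
  have hne : Nonempty (Fin k) := by
    by_contra hk
    rw [not_nonempty_iff] at hk
    refine hnpi ⟨Set.univ, Set.infinite_univ, fun C hC => ?_⟩
    rw [← hpart] at hC
    obtain ⟨i, -⟩ := Set.mem_iUnion.1 hC
    exact hk.elim i
  have hC : ⋂₀ (Set.range B) ∈ ℱ :=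
    hclosed _ (by rintro _ ⟨i, rfl⟩; exact hBF i) (Set.finite_range B) (Set.range_nonempty B)
  rw [← hpart] at hC
  obtain ⟨j, hj⟩ := Set.mem_iUnion.1 hC
  exact hBinf j (((hA j).2 _ hj).subset
    (Set.diff_subset_diff_right (Set.sInter_subset_of_mem ⟨j, rfl⟩)))
end

section
/- The cardinal 𝔭_σ equals the minimal cardinality of a centered family ℱ ⊆ [ℕ]^ω such that for every partition ℱ = ⋃_{n∈ℕ} ℱₙ into countably many pieces, there is some n such that the intersection ⋂ℱₙ is finite. -/
open Set Topology Filter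

/-- 𝔭_σ equals the minimal cardinality of a centered family such
that in every countable partition some piece has finite intersection. -/
theorem statement2 :
    pSigmaNumber = sInf { c : Cardinal | ∃ ℱ : Set (Set ℕ), IsCentered ℱ ∧
      (∀ 𝒬 : ℕ → Set (Set ℕ), (⋃ n, 𝒬 n) = ℱ → ∃ n, (⋂₀ 𝒬 n).Finite) ∧
      Cardinal.mk ℱ = c } := by
  unfold pSigmaNumber
  congr 1
  ext c
  constructor
  · rintro ⟨ℱ, hc, h, rfl⟩
    refine ⟨ℱ, hc, fun 𝒬 hQ => ?_, rfl⟩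
    obtain ⟨n, hn⟩ := h 𝒬 hQ
    refine ⟨n, ?_⟩
    by_contra hinf
    refine hn ⟨⋂₀ 𝒬 n, hinf, fun B hB => ?_⟩
    rw [Set.diff_eq_empty.mpr (Set.sInter_subset_of_mem hB)]
    exact Set.finite_empty
  · rintro ⟨ℱ, hc, h, rfl⟩
    refine ⟨ℱ, hc, fun 𝒬 hQ => ?_, rfl⟩
    by_contra! hA
    choose A hAinf hAfin using hA
    obtain ⟨k, hk⟩ := h (fun k => {B | B ∈ 𝒬 k.unpair.1 ∧
        ∀ x ∈ A k.unpair.1 \ B, x ≤ k.unpair.2}) (by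
      rw [← hQ]
      ext B
      simp only [Set.mem_iUnion, Set.mem_setOf_eq]
      constructor
      · rintro ⟨k, hk, -⟩
        exact ⟨_, hk⟩
      · rintro ⟨n, hn⟩
        obtain ⟨m, hm⟩ := (hAfin n B hn).bddAbove
        refine ⟨Nat.pair n m, ?_⟩
        simp only [Nat.unpair_pair]
        exact ⟨hn, fun x hx => hm hx⟩)
    refine ((hAinf k.unpair.1).diff (Set.finite_Iic k.unpair.2)) (hk.subset ?_)
    rintro x ⟨hxA, hx⟩ B ⟨-, hB⟩
    by_contra hxB
    exact hx (hB x ⟨hxA, hxB⟩)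
end

section
/- Let X be a topological space such that C_p(X) has countable tightness. If the cardinality of X is strictly less than 𝔭_σ, then C_p(X) has the Pytkeev property. -/
open Set Topology Filter

universe u

lemma pytkeev_aux_infinite {Y : Type*} [TopologicalSpace Y] [T1Space Y] {B : Set Y} {y : Y}
    (hy : y ∈ closure B) (hyB : y ∉ B) {U : Set Y} (hU : U ∈ 𝓝 y) : (U ∩ B).Infinite := by
  intro hfin
  have h1 : (U ∩ B)ᶜ ∈ 𝓝 y := hfin.isClosed.isOpen_compl.mem_nhds (fun h => hyB h.2)
  obtain ⟨z, hz, hzB⟩ := mem_closure_iff_nhds.1 hy _ (Filter.inter_mem hU h1)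
  exact hz.2 ⟨hz.1, hzB⟩

lemma sigma_aux {X : Type u} (S : Finset X × ℕ → Set ℕ)
    (hcard : Cardinal.mk X < Cardinal.lift.{u} pSigmaNumber)
    (hcen : IsCentered (Set.range S)) :
    ∃ 𝒬 : ℕ → Set (Set ℕ), (⋃ n, 𝒬 n) = Set.range S ∧
      ∀ n, ∃ A, IsPseudoIntersection A (𝒬 n) := by
  classical
  by_cases hc : (Set.range S).Countable
  · obtain ⟨f, hf⟩ := hc.exists_eq_range (Set.range_nonempty_iff_nonempty.2 ⟨(∅, 0)⟩)
    refine ⟨fun n => {f n}, ?_, fun n => ⟨f n, ?_, ?_⟩⟩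
    · rw [hf]; ext; simp [eq_comm]
    · have := hcen {f n} (by rw [hf]; simp) (Set.finite_singleton _) (Set.singleton_nonempty _)
      simpa using this
    · intro B hB
      rw [Set.mem_singleton_iff.1 hB]; simp
  · have hinf : Infinite X := by
      by_contra h
      rw [not_infinite_iff_finite] at h
      exact hc (Set.countable_range S)
    have hlt : Cardinal.mk (Set.range S) < pSigmaNumber := by
      rw [← Cardinal.lift_lt.{0, u}]
      refine lt_of_le_of_lt (Cardinal.mk_range_le_lift (f := S)) ?_
      have : Cardinal.mk (Finset X × ℕ) = Cardinal.mk X := by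
        rw [Cardinal.mk_prod]
        simp [Cardinal.mk_finset_of_infinite, Cardinal.mul_aleph0_eq]
      rw [this]
      simpa using hcard
    have := notMem_of_lt_csInf' hlt
    by_contra hcon
    apply this
    refine ⟨_, hcen, ?_, rfl⟩
    intro 𝒬 h𝒬
    by_contra h2
    push Not at h2
    exact hcon ⟨𝒬, h𝒬, h2⟩

/-- if `C_p(X)` has countable tightness and `|X| < 𝔭_σ`, then
`C_p(X)` has the Pytkeev property. -/
theorem statement3 (X : Type u) [TopologicalSpace X]
    (hct : CountableTightness (Cp X))
    (hcard : Cardinal.mk X < Cardinal.lift.{u} pSigmaNumber) :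
    PytkeevProp (Cp X) := by
  classical
  rintro A y ⟨hyA, hyn⟩
  obtain ⟨B, hBA, hBc, hyB⟩ := hct A y hyA
  have hynB : y ∉ B := fun h => hyn (hBA h)
  have hBinf : B.Infinite := by
    simpa using pytkeev_aux_infinite hyB hynB Filter.univ_mem
  have : Infinite B := hBinf.to_subtype
  have : Countable B := hBc.to_subtype
  obtain ⟨e⟩ : Nonempty (ℕ ≃ B) := nonempty_equiv_of_countable
  let V : Finset X × ℕ → Set (Cp X) := fun p =>
    {f | ∀ x ∈ p.1, |f.1 x - y.1 x| < 1 / ((p.2 : ℝ) + 1)}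
  have hVn : ∀ p, V p ∈ 𝓝 y := by
    intro p
    have : V p = ⋂ x ∈ p.1, {f : Cp X | |f.1 x - y.1 x| < 1 / ((p.2 : ℝ) + 1)} := by
      ext f; simp [V]
    rw [this, Filter.biInter_finset_mem]
    intro x _
    have hcont : Continuous fun f : Cp X => |f.1 x - y.1 x| :=
      (((continuous_apply x).comp continuous_subtype_val).sub continuous_const).abs
    refine (isOpen_lt hcont continuous_const).mem_nhds ?_
    have : (0 : ℝ) < 1 / ((p.2 : ℝ) + 1) := by positivity
    simpa using this
  have hVb : ∀ U ∈ 𝓝 y, ∃ p, V p ⊆ U := by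
    intro U hU
    rw [nhds_subtype_eq_comap, Filter.mem_comap] at hU
    obtain ⟨W, hW, hWU⟩ := hU
    rw [nhds_pi, Filter.mem_pi] at hW
    obtain ⟨I, hI, t, ht, htW⟩ := hW
    have h1 : ∀ x, ∃ k : ℕ, ∀ r : ℝ, |r - y.1 x| < 1 / ((k : ℝ) + 1) → r ∈ t x := by
      intro x
      obtain ⟨ε, hε, hb⟩ := Metric.mem_nhds_iff.1 (ht x)
      obtain ⟨k, hk⟩ := exists_nat_one_div_lt hε
      exact ⟨k, fun r hr => hb (by rw [Metric.mem_ball, Real.dist_eq]; exact hr.trans hk)⟩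
    choose k hk using h1
    refine ⟨(hI.toFinset, hI.toFinset.sup k), fun f hf => hWU (htW ?_)⟩
    intro x hx
    apply hk
    refine lt_of_lt_of_le (hf x (by simpa using hx)) ?_
    apply one_div_le_one_div_of_le (by positivity)
    have : k x ≤ hI.toFinset.sup k := Finset.le_sup (by simpa using hx)
    have : (k x : ℝ) ≤ ((hI.toFinset.sup k : ℕ) : ℝ) := by exact_mod_cast this
    simpa using this
  let S : Finset X × ℕ → Set ℕ := fun p => {n | (e n : Cp X) ∈ V p}
  have hcen : IsCentered (Set.range S) := by
    intro 𝒢 h𝒢 hfin _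
    have hN : (⋂ s ∈ 𝒢, {f : Cp X | ∀ n, (e n : Cp X) = f → n ∈ s}) ∈ 𝓝 y := by
      rw [Filter.biInter_mem hfin]
      intro s hs
      obtain ⟨p, rfl⟩ := h𝒢 hs
      refine Filter.mem_of_superset (hVn p) ?_
      rintro f hf n rfl
      exact hf
    have hi := pytkeev_aux_infinite hyB hynB hN
    intro hf
    apply hi
    refine (hf.image (fun n => (e n : Cp X))).subset ?_
    rintro f ⟨hf1, hf2⟩
    refine ⟨e.symm ⟨f, hf2⟩, ?_, by simp⟩
    intro s hs
    exact Set.mem_iInter₂.1 hf1 s hs _ (by simp)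
  obtain ⟨𝒬, h𝒬, hP⟩ := sigma_aux S hcard hcen
  choose P hP using hP
  refine ⟨fun m => (fun n => (e n : Cp X)) '' (P m.unpair.1 \ Set.Iio m.unpair.2), ?_, ?_⟩
  · intro m
    refine ⟨?_, ?_⟩
    · apply Set.Infinite.image
      · intro a _ b _ hab
        exact e.injective (Subtype.ext hab)
      · exact (hP _).1.sdiff (Set.finite_Iio _)
    · rintro _ ⟨n, _, rfl⟩
      exact hBA (e n).2
  · intro U hU
    obtain ⟨p, hp⟩ := hVb U hU
    have hmem : S p ∈ ⋃ n, 𝒬 n := by rw [h𝒬]; exact ⟨p, rfl⟩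
    obtain ⟨i, hi⟩ := Set.mem_iUnion.1 hmem
    obtain ⟨b, hb⟩ := ((hP i).2 _ hi).bddAbove
    refine ⟨Nat.pair i (b + 1), ?_⟩
    rintro _ ⟨n, hn, rfl⟩
    simp only [Nat.unpair_pair, Set.mem_sdiff, Set.mem_Iio, not_lt] at hn
    apply hp
    by_contra hc
    have : n ≤ b := hb ⟨hn.1, hc⟩
    omega
end

section
/- There exists a set X ⊆ ℝ of cardinality 𝔭_σ such that C_p(X) does not have the Pytkeev property. -/
open Set Topology Filter

lemma exists_splitting (A : ℕ → Set ℕ) (hA : ∀ n, (A n).Infinite) :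
    ∃ B : Set ℕ, ∀ n, (A n \ B).Infinite ∧ (A n \ Bᶜ).Infinite := by
  obtain ⟨φ, hφ, hP⟩ := Filter.extraction_forall_of_frequently
    (P := fun i k => k ∈ A (Nat.unpair i).1)
    (fun i => Nat.frequently_atTop_iff_infinite.2 (hA _))
  refine ⟨{m | ∃ i, φ i = m ∧ (Nat.unpair i).2 % 2 = 0}, fun n => ⟨?_, ?_⟩⟩
  · refine Set.infinite_of_injective_forall_mem
      (f := fun k : ℕ => φ (Nat.pair n (2 * k + 1))) ?_ ?_
    · intro a b h
      have := hφ.injective h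
      simp only [Nat.pair_eq_pair] at this
      omega
    · intro k
      refine ⟨by simpa using hP (Nat.pair n (2 * k + 1)), ?_⟩
      rintro ⟨i, hi, h⟩
      have := hφ.injective hi
      subst this
      simp at h
  · refine Set.infinite_of_injective_forall_mem
      (f := fun k : ℕ => φ (Nat.pair n (2 * k))) ?_ ?_
    · intro a b h
      have := hφ.injective h
      simp only [Nat.pair_eq_pair] at this
      omega
    · intro k
      refine ⟨by simpa using hP (Nat.pair n (2 * k)), ?_⟩
      intro h
      exact h ⟨_, rfl, by simp⟩

lemma pSigma_nonempty : ∃ ℱ : Set (Set ℕ), IsCentered ℱ ∧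
    (∀ 𝒬 : ℕ → Set (Set ℕ), (⋃ n, 𝒬 n) = ℱ →
      ∃ n, ¬ ∃ A, IsPseudoIntersection A (𝒬 n)) := by
  refine ⟨{s | s ∈ hyperfilter ℕ}, ?_, ?_⟩
  · intro 𝒢 h𝒢 hfin _ hinf
    exact Filter.notMem_hyperfilter_of_finite hinf ((Filter.sInter_mem hfin).2 fun s hs => h𝒢 hs)
  · intro 𝒬 h𝒬
    by_contra! hcon
    choose A hA using hcon
    obtain ⟨B, hB⟩ := exists_splitting A fun n => (hA n).1
    rcases (hyperfilter ℕ).mem_or_compl_mem B with h | h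
    · have h' : B ∈ ⋃ n, 𝒬 n := h𝒬 ▸ h
      obtain ⟨n, hn⟩ := mem_iUnion.1 h'
      exact (hB n).1 ((hA n).2 _ hn)
    · have h' : Bᶜ ∈ ⋃ n, 𝒬 n := h𝒬 ▸ h
      obtain ⟨n, hn⟩ := mem_iUnion.1 h'
      exact (hB n).2 ((hA n).2 _ hn)

lemma exists_coding : ∃ (e : Set ℕ → ℝ) (d : ℝ → Set ℕ), (∀ s, d (e s) = s) ∧
    ∀ (n : ℕ) (a b : ℝ), ∀ X : Set ℝ, X ⊆ range e →
      ∃ g : X → ℝ, Continuous g ∧ ∀ x : X, (n ∈ d x → g x = a) ∧ (n ∉ d x → g x = b) := by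
  classical
  obtain ⟨f, -, hc, hi⟩ := IsClosed.exists_nat_bool_injection_of_not_countable
    (isClosed_univ : IsClosed (univ : Set ℝ)) Cardinal.not_countable_real
  have hemb : IsEmbedding f := (hc.isClosedEmbedding hi).isEmbedding
  let inv : ℝ → (ℕ → Bool) := Function.invFun f
  have hinv : ∀ u, inv (f u) = u := Function.leftInverse_invFun hi
  refine ⟨fun s => f fun n => decide (n ∈ s), fun x => {n | inv x n = true}, ?_, ?_⟩
  · intro s
    ext n
    simp [hinv]
  · intro n a b X hX
    refine ⟨fun x => (fun t : Bool => if t then a else b) (inv x n), ?_, ?_⟩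
    · have h1 : Continuous fun x : X => inv x := by
        rw [hemb.continuous_iff]
        have : (f ∘ fun x : X => inv x) = Subtype.val := by
          funext x
          obtain ⟨s, hs⟩ := hX x.2
          simp only [Function.comp_apply]
          rw [← hs]
          simp [hinv]
        rw [this]
        exact continuous_subtype_val
      exact (continuous_of_discreteTopology (f := fun t : Bool => if t then a else b)).comp
        ((continuous_apply n).comp h1)
    · intro x
      constructor
      · intro h
        have h : inv x n = true := h
        simp [h]
      · intro h
        have h : ¬ inv x n = true := h
        simp [h]

/-- there is a set of reals of cardinality 𝔭_σ whose `C_p` does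
not have the Pytkeev property. -/
theorem statement4 :
    ∃ X : Set ℝ, Cardinal.mk X = pSigmaNumber ∧ ¬ PytkeevProp (Cp X) := by
  have hmem : pSigmaNumber ∈ { c : Cardinal | ∃ ℱ : Set (Set ℕ), IsCentered ℱ ∧
    (∀ 𝒬 : ℕ → Set (Set ℕ), (⋃ n, 𝒬 n) = ℱ →
      ∃ n, ¬ ∃ A, IsPseudoIntersection A (𝒬 n)) ∧ Cardinal.mk ℱ = c } := by
    apply csInf_mem
    obtain ⟨ℱ, h1, h2⟩ := pSigma_nonempty
    exact ⟨_, ℱ, h1, h2, rfl⟩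
  obtain ⟨ℱ, hcent, hσ, hcard⟩ := hmem
  obtain ⟨e, d, hde, hg⟩ := exists_coding
  have he : Function.Injective e := Function.LeftInverse.injective hde
  refine ⟨e '' ℱ, by rw [Cardinal.mk_image_eq he, hcard], ?_⟩
  intro hP
  have hne : ℱ.Nonempty := by
    by_contra hemp
    rw [not_nonempty_iff_eq_empty] at hemp
    obtain ⟨n, hn⟩ := hσ (fun _ => ∅) (by simp [hemp])
    exact hn ⟨univ, infinite_univ, by simp⟩
  choose g hgc hgv using fun n : ℕ =>
    hg n (1 / ((n : ℝ) + 1)) 2 (e '' ℱ) (image_subset_range _ _)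
  let G : ℕ → Cp (e '' ℱ) := fun n => ⟨g n, hgc n⟩
  let z : Cp (e '' ℱ) := ⟨fun _ => 0, continuous_const⟩
  have hdX : ∀ x : (e '' ℱ : Set ℝ), d x ∈ ℱ := by
    rintro ⟨_, s, hs, rfl⟩
    simpa [hde] using hs
  have hz : z ∈ closure (range G) \ range G := by
    constructor
    · rw [closure_subtype, mem_closure_iff_nhds]
      intro U hU
      rw [nhds_pi, Filter.mem_pi] at hU
      obtain ⟨I, hI, t, ht, htU⟩ := hU
      have hinf : {n | ∀ x ∈ I, n ∈ d x}.Infinite := by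
        by_cases hIe : I.Nonempty
        · have := hcent ((fun x : (e '' ℱ : Set ℝ) => d x) '' I)
            (by rintro _ ⟨x, _, rfl⟩; exact hdX x) (hI.image _) (hIe.image _)
          convert this using 1
          ext n
          simp only [sInter_image, mem_iInter]
          rfl
        · rw [not_nonempty_iff_eq_empty] at hIe
          simpa [hIe] using infinite_univ
      have hev : ∀ᶠ n : ℕ in atTop, ∀ x ∈ I, 1 / ((n : ℝ) + 1) ∈ t x := by
        rw [hI.eventually_all]
        intro x _
        exact tendsto_one_div_add_atTop_nhds_zero_nat (ht x)
      obtain ⟨n, hn1, hn2⟩ := ((Nat.frequently_atTop_iff_infinite.2 hinf).and_eventually hev).exists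
      refine ⟨g n, htU fun x hx => ?_, ⟨G n, mem_range_self n, rfl⟩⟩
      rw [(hgv n x).1 (hn1 x hx)]
      exact hn2 x hx
    · rintro ⟨n, hn⟩
      obtain ⟨s, hs⟩ := hne
      have h0 : g n ⟨e s, mem_image_of_mem e hs⟩ = 0 :=
        congrFun (congrArg Subtype.val hn) ⟨e s, mem_image_of_mem e hs⟩
      have hp : (0 : ℝ) < 1 / ((n : ℝ) + 1) := by positivity
      by_cases h : n ∈ d (e s)
      · have := (hgv n ⟨e s, mem_image_of_mem e hs⟩).1 h
        linarith
      · have := (hgv n ⟨e s, mem_image_of_mem e hs⟩).2 h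
        linarith
  obtain ⟨𝒜, h𝒜, hU⟩ := hP _ z hz
  let B : ℕ → Set ℕ := fun k => {n | G n ∈ 𝒜 k}
  have hB : ∀ k, (B k).Infinite := by
    intro k hfin
    refine (h𝒜 k).1 ((hfin.image G).subset ?_)
    intro y hy
    obtain ⟨n, rfl⟩ := (h𝒜 k).2 hy
    exact ⟨n, hy, rfl⟩
  obtain ⟨k, hk⟩ := hσ (fun k => {F | F ∈ ℱ ∧ B k ⊆ F}) (by
    ext F
    simp only [mem_iUnion, mem_setOf_eq]
    constructor
    · rintro ⟨_, h, _⟩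
      exact h
    · intro hF
      let x : (e '' ℱ : Set ℝ) := ⟨e F, mem_image_of_mem e hF⟩
      have hopen : {f : Cp (e '' ℱ) | f.1 x < 2} ∈ nhds z := by
        apply IsOpen.mem_nhds
        · exact isOpen_lt ((continuous_apply x).comp continuous_subtype_val) continuous_const
        · show (0 : ℝ) < 2
          norm_num
      obtain ⟨k, hk⟩ := hU _ hopen
      refine ⟨k, hF, fun n hn => ?_⟩
      by_contra hnF
      have h1 : g n x < 2 := hk hn
      have h2 := (hgv n x).2 (by show n ∉ d (e F); rwa [hde])
      linarith)
  exact hk ⟨B k, hB k, fun F hF => by simp [diff_eq_empty.2 hF.2]⟩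
end

section
/- 𝔭_σ = 𝔭: the minimal cardinality of a centered family ℱ ⊆ [ℕ]^ω such that every countable partition of ℱ has a piece with no pseudo-intersection equals the pseudo-intersection number 𝔭. -/
open Set Topology Filter

namespace PS

/-- almost inclusion -/
def AS (A B : Set ℕ) : Prop := (A \ B).Finite

lemma AS.trans {A B C : Set ℕ} (h : AS A B) (h' : AS B C) : AS A C := by
  refine (Set.Finite.union h h').subset ?_
  rintro x ⟨hx, hc⟩
  by_cases hb : x ∈ B
  · exact Or.inr ⟨hb, hc⟩
  · exact Or.inl ⟨hx, hb⟩

lemma AS.of_subset {A B : Set ℕ} (h : A ⊆ B) : AS A B := by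
  unfold AS
  rw [Set.sdiff_eq_empty.2 h]
  exact Set.finite_empty

lemma AS.inter {A B C : Set ℕ} (h : AS A B) (h' : AS A C) : AS A (B ∩ C) := by
  refine (Set.Finite.union h h').subset ?_
  rintro x ⟨hx, hc⟩
  by_cases hb : x ∈ B
  · exact Or.inr ⟨hx, fun h => hc ⟨hb, h⟩⟩
  · exact Or.inl ⟨hx, hb⟩

lemma AS.infinite {A B : Set ℕ} (h : AS A B) (hA : A.Infinite) : B.Infinite := by
  intro hB
  refine hA ((Set.Finite.union h hB).subset ?_)
  intro x hx
  by_cases hb : x ∈ B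
  · exact Or.inr hb
  · exact Or.inl ⟨hx, hb⟩

def Chain (S : Set (Set ℕ)) : Prop := ∀ A ∈ S, ∀ B ∈ S, AS A B ∨ AS B A

def Split (S : Set (Set ℕ)) : Prop :=
  ∃ A : ℕ → Set ℕ, (∀ n, (A n).Infinite) ∧ ∀ F ∈ S, ∃ n, AS (A n) F

def HH (κ : Cardinal) : Prop :=
  ∀ S : Set (Set ℕ), IsCentered S → Cardinal.mk S ≤ κ → Split S

lemma dirmin {S : Set (Set ℕ)} (hd : ∀ X ∈ S, ∀ Y ∈ S, ∃ Z ∈ S, AS Z X ∧ AS Z Y)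
    (hne : S.Nonempty) {G : Set (Set ℕ)} (hG : G.Finite) :
    G ⊆ S → ∃ Z ∈ S, ∀ X ∈ G, AS Z X := by
  induction G, hG using Set.Finite.induction_on with
  | empty => intro _; obtain ⟨Z, hZ⟩ := hne; exact ⟨Z, hZ, by simp⟩
  | @insert a s _ _ ih =>
    intro h
    obtain ⟨Z, hZ, hZs⟩ := ih (fun x hx => h (Or.inr hx))
    obtain ⟨W, hW, h1, h2⟩ := hd a (h (Or.inl rfl)) Z hZ
    refine ⟨W, hW, ?_⟩
    rintro X (rfl | hX)
    · exact h1
    · exact h2.trans (hZs X hX)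

lemma as_sInter {Z : Set ℕ} {G : Set (Set ℕ)} (hG : G.Finite) (h : ∀ X ∈ G, AS Z X) :
    AS Z (⋂₀ G) := by
  refine (hG.biUnion h).subset ?_
  rintro x ⟨hx, hc⟩
  simp only [Set.mem_sInter, not_forall] at hc
  obtain ⟨X, hX, hxX⟩ := hc
  exact Set.mem_biUnion hX ⟨hx, hxX⟩

lemma dir_centered {S : Set (Set ℕ)} (hd : ∀ X ∈ S, ∀ Y ∈ S, ∃ Z ∈ S, AS Z X ∧ AS Z Y)
    (hi : ∀ X ∈ S, X.Infinite) : IsCentered S := by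
  intro G hGS hG hne
  obtain ⟨Z, hZ, h⟩ := dirmin hd (hne.mono hGS) hG hGS
  exact (as_sInter hG h).infinite (hi Z hZ)

lemma Chain.dir {S : Set (Set ℕ)} (h : Chain S) :
    ∀ X ∈ S, ∀ Y ∈ S, ∃ Z ∈ S, AS Z X ∧ AS Z Y := by
  intro X hX Y hY
  rcases h X hX Y hY with h | h
  · exact ⟨X, hX, AS.of_subset le_rfl, h⟩
  · exact ⟨Y, hY, h, AS.of_subset le_rfl⟩

def Pos (𝓕 : Set (Set ℕ)) (B : Set ℕ) : Prop := ∀ F ∈ 𝓕, (B ∩ F).Infinite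

open Filter in
lemma case1 {𝓕 : Set (Set ℕ)} (hdom : ∀ f : 𝓕 → ℕ → ℕ, ∃ g : ℕ → ℕ, ∀ F, ∀ᶠ n in atTop, f F n ≤ g n)
    (D : ℕ → Set ℕ) (hD : Chain (Set.range D)) (hQ : ∀ n, Pos 𝓕 (D n)) :
    ∃ C, Pos 𝓕 C ∧ ∀ n, AS C (D n) := by
  have h1 : ∀ k, ∀ F : 𝓕, ∃ x, k ≤ x ∧ x ∈ F.1 ∧ ∀ i ≤ k, x ∈ D i := by
    intro k F
    have hfin : (D '' Set.Iic k).Finite := (Set.finite_Iic k).image D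
    obtain ⟨Z, ⟨m, rfl⟩, hZ⟩ := dirmin hD.dir ⟨_, ⟨0, rfl⟩⟩ hfin (Set.image_subset_range _ _)
    have h2 := as_sInter hfin hZ
    have h3 : AS (D m ∩ F.1) (⋂₀ (D '' Set.Iic k) ∩ F.1) :=
      ((AS.of_subset Set.inter_subset_left).trans h2).inter (AS.of_subset Set.inter_subset_right)
    obtain ⟨x, hx, hkx⟩ := (h3.infinite (hQ m F F.2)).exists_gt k
    refine ⟨x, hkx.le, hx.2, fun i hi => ?_⟩
    exact hx.1 (D i) ⟨i, hi, rfl⟩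
  choose f hf1 hf2 hf3 using h1
  obtain ⟨g, hg⟩ := hdom (fun F k => f k F)
  refine ⟨{x | ∃ k, x ≤ g k ∧ ∀ i ≤ k, x ∈ D i}, ?_, ?_⟩
  · intro F hF
    obtain ⟨N, hN⟩ := eventually_atTop.1 (hg ⟨F, hF⟩)
    rw [Set.infinite_iff_exists_gt]
    intro a
    refine ⟨f (max N (a+1)) ⟨F, hF⟩, ⟨⟨max N (a+1), hN _ (le_max_left _ _), hf3 _ _⟩, hf2 _ ⟨F, hF⟩⟩, ?_⟩
    have := hf1 (max N (a+1)) ⟨F, hF⟩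
    omega
  · intro n
    refine (Set.Finite.biUnion (Set.finite_Iio n) (fun k _ => Set.finite_Iic (g k))).subset ?_
    rintro x ⟨⟨k, hk, hx⟩, hn⟩
    have : k < n := by
      by_contra hc
      exact hn (hx n (by omega))
    exact Set.mem_biUnion this hk

def CC (S : Set (Set ℕ)) : Prop := ∃ D : ℕ → Set ℕ, (∀ n, D n ∈ S) ∧ ∀ B ∈ S, ∃ n, AS (D n) B

lemma case2 {𝓕 S : Set (Set ℕ)} {κ : Cardinal} (hω : Cardinal.aleph0 ≤ κ) (H : HH κ)
    (hF : Cardinal.mk 𝓕 ≤ κ) (hS : Cardinal.mk S ≤ κ)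
    (hdir : ∀ X ∈ 𝓕, ∀ Y ∈ 𝓕, X ∩ Y ∈ 𝓕) (hne : S.Nonempty)
    (hch : Chain S) (hQ : ∀ B ∈ S, Pos 𝓕 B) (hcc : ¬ CC S) :
    ∃ A : ℕ → Set ℕ, (∀ n, (A n).Infinite) ∧
      ∀ F ∈ 𝓕, ∃ n, AS (A n) F ∧ ∀ B ∈ S, AS (A n) B := by
  have hcen : IsCentered (Set.image2 (· ∩ ·) S 𝓕) := by
    apply dir_centered
    · rintro _ ⟨B, hB, F, hF, rfl⟩ _ ⟨B', hB', F', hF', rfl⟩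
      obtain ⟨Z, hZ, h1, h2⟩ := hch.dir B hB B' hB'
      refine ⟨_, ⟨Z, hZ, F ∩ F', hdir F hF F' hF', rfl⟩, ?_, ?_⟩
      · exact ((AS.of_subset Set.inter_subset_left).trans h1).inter
          (AS.of_subset fun x hx => hx.2.1)
      · exact ((AS.of_subset Set.inter_subset_left).trans h2).inter
          (AS.of_subset fun x hx => hx.2.2)
    · rintro _ ⟨B, hB, F, hF, rfl⟩
      exact hQ B hB F hF
  have hcard : Cardinal.mk (Set.image2 (· ∩ ·) S 𝓕) ≤ κ := by
    refine (Cardinal.mk_image2_le).trans ?_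
    exact (mul_le_mul' hS hF).trans (Cardinal.mul_eq_self hω).le
  obtain ⟨A, hA, hA2⟩ := H _ hcen hcard
  refine ⟨A, hA, fun F hF => ?_⟩
  by_contra hcon
  push Not at hcon
  have : ∀ n, ∃ B ∈ S, AS (A n) F → ¬ AS (A n) B := by
    intro n
    by_cases h : AS (A n) F
    · obtain ⟨B, hB, h'⟩ := hcon n h
      exact ⟨B, hB, fun _ => h'⟩
    · obtain ⟨B, hB⟩ := hne
      exact ⟨B, hB, fun h' => absurd h' h⟩
  choose D hD hD2 using this
  refine hcc ⟨D, hD, fun B hB => ?_⟩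
  obtain ⟨n, hn⟩ := hA2 _ ⟨B, hB, F, hF, rfl⟩
  refine ⟨n, (hch _ (hD n) _ hB).resolve_right fun hBD => ?_⟩
  exact hD2 n (hn.trans (AS.of_subset Set.inter_subset_right))
    ((hn.trans (AS.of_subset Set.inter_subset_left)).trans hBD)

lemma chain_inf {S : Set (Set ℕ)} {κ : Cardinal} (hω : Cardinal.aleph0 ≤ κ) (H : HH κ)
    (hS : Cardinal.mk S ≤ κ) (hch : Chain S) (hQ : ∀ B ∈ S, B.Infinite) :
    ∃ C : Set ℕ, C.Infinite ∧ ∀ B ∈ S, AS C B := by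
  rcases S.eq_empty_or_nonempty with rfl | hne
  · exact ⟨Set.univ, Set.infinite_univ, by simp⟩
  have hQ' : ∀ B ∈ S, Pos {Set.univ} B := by
    rintro B hB F rfl
    simpa using hQ B hB
  by_cases hcc : CC S
  · obtain ⟨D, hD, hD2⟩ := hcc
    obtain ⟨C, hC, hC2⟩ := case1 (𝓕 := {Set.univ}) (fun f => ⟨f ⟨Set.univ, rfl⟩, by
      rintro ⟨F, rfl⟩; exact Filter.Eventually.of_forall fun _ => le_rfl⟩) D
      (by rintro _ ⟨n, rfl⟩ _ ⟨m, rfl⟩; exact hch _ (hD n) _ (hD m)) (fun n => hQ' _ (hD n))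
    refine ⟨C, by simpa using hC _ rfl, fun B hB => ?_⟩
    obtain ⟨n, hn⟩ := hD2 B hB
    exact (hC2 n).trans hn
  · obtain ⟨A, hA, hA2⟩ := case2 (𝓕 := {Set.univ}) hω H
      (by simpa using (Cardinal.one_le_aleph0.trans hω)) hS
      (by rintro _ rfl _ rfl; simp) hne hch hQ' hcc
    obtain ⟨n, -, hn⟩ := hA2 _ rfl
    exact ⟨A n, hA n, hn⟩

/-- transfinite construction -/
lemma build {ι : Type} {κ : Cardinal} (hι : Cardinal.mk ι ≤ κ) (Q : Set ℕ → Prop)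
    (P : ι → Set ℕ → Prop)
    (hL : ∀ S : Set (Set ℕ), Cardinal.mk S ≤ κ → Chain S → (∀ B ∈ S, Q B) →
      ∃ C, Q C ∧ ∀ B ∈ S, AS C B)
    (hP : ∀ i C, Q C → ∃ B, B ⊆ C ∧ Q B ∧ P i B) :
    ∃ B : ι → Set ℕ, Chain (Set.range B) ∧ ∀ i, Q (B i) ∧ P i (B i) := by
  have hL' : ∀ S : Set (Set ℕ), ∃ C, (Cardinal.mk S ≤ κ ∧ Chain S ∧ ∀ B ∈ S, Q B) →
      Q C ∧ ∀ B ∈ S, AS C B := by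
    intro S
    by_cases h : Cardinal.mk S ≤ κ ∧ Chain S ∧ ∀ B ∈ S, Q B
    · obtain ⟨C, hC⟩ := hL S h.1 h.2.1 h.2.2
      exact ⟨C, fun _ => hC⟩
    · exact ⟨∅, fun h' => absurd h' h⟩
  choose L hL using hL'
  have hP' : ∀ i C, ∃ B, Q C → B ⊆ C ∧ Q B ∧ P i B := by
    intro i C
    by_cases h : Q C
    · obtain ⟨B, hB⟩ := hP i C h
      exact ⟨B, fun _ => hB⟩
    · exact ⟨∅, fun h' => absurd h' h⟩
  choose T hT using hP'
  let r : ι → ι → Prop := WellOrderingRel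
  have wf : WellFounded r := IsWellFounded.wf
  let B : ι → Set ℕ := wf.fix fun i ih => T i (L (Set.range fun j : {j // r j i} => ih j.1 j.2))
  have hB : ∀ i, B i = T i (L (Set.range fun j : {j // r j i} => B j.1)) := fun i =>
    wf.fix_eq _ i
  have main : ∀ i, (Q (B i) ∧ P i (B i)) ∧ ∀ j, r j i → AS (B i) (B j) := by
    intro i
    induction i using wf.induction with
    | _ i ih =>
      have key := hL (Set.range fun j : {j // r j i} => B j.1) ⟨?_, ?_, ?_⟩
      · have k2 := hT i _ key.1
        rw [← hB] at k2
        exact ⟨k2.2, fun j hj => (AS.of_subset k2.1).trans (key.2 _ ⟨⟨j, hj⟩, rfl⟩)⟩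
      · exact (Cardinal.mk_range_le.trans (Cardinal.mk_subtype_le _)).trans hι
      · rintro _ ⟨⟨j, hj⟩, rfl⟩ _ ⟨⟨k, hk⟩, rfl⟩
        rcases trichotomous_of r j k with h | h | h
        · exact Or.inr ((ih k hk).2 j h)
        · subst h; exact Or.inl (AS.of_subset le_rfl)
        · exact Or.inl ((ih j hj).2 k h)
      · rintro _ ⟨⟨j, hj⟩, rfl⟩
        exact (ih j hj).1.1
  refine ⟨B, ?_, fun i => (main i).1⟩
  rintro _ ⟨j, rfl⟩ _ ⟨k, rfl⟩
  rcases trichotomous_of r j k with h | h | h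
  · exact Or.inr ((main k).2 j h)
  · subst h; exact Or.inl (AS.of_subset le_rfl)
  · exact Or.inl ((main j).2 k h)

lemma sparse (f : ℕ → ℕ) (C : Set ℕ) (hC : C.Infinite) :
    ∃ B, B ⊆ C ∧ B.Infinite ∧ ∀ x ∈ B, ∀ y ∈ B, x < y → ∀ i ≤ x, f i ≤ y := by
  have h1 : ∀ x, ∃ y ∈ C, x < y ∧ ∀ i ≤ x, f i ≤ y := by
    intro x
    obtain ⟨y, hy, h⟩ := hC.exists_gt (x + (Finset.range (x+1)).sup f)
    refine ⟨y, hy, by omega, fun i hi => ?_⟩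
    have := Finset.le_sup (f := f) (show i ∈ Finset.range (x+1) from Finset.mem_range.2 (Nat.lt_succ_of_le hi))
    omega
  choose s hs1 hs2 hs3 using h1
  let e : ℕ → ℕ := fun n => s^[n+1] 0
  have he : ∀ n, e (n+1) = s (e n) := fun n => Function.iterate_succ_apply' s (n+1) 0
  have hmono : StrictMono e := strictMono_nat_of_lt_succ fun n => by rw [he]; exact hs2 _
  refine ⟨Set.range e, ?_, Set.infinite_range_of_injective hmono.injective, ?_⟩
  · rintro _ ⟨n, rfl⟩
    show s^[n+1] 0 ∈ C
    rw [Function.iterate_succ_apply']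
    exact hs1 _
  · rintro _ ⟨n, rfl⟩ _ ⟨m, rfl⟩ hlt i hi
    have hnm : n + 1 ≤ m := hmono.lt_iff_lt.1 hlt
    refine (hs3 (e n) i hi).trans ?_
    rw [← he]
    exact hmono.monotone hnm

open Filter in
lemma dom {ι : Type} {κ : Cardinal} (hω : Cardinal.aleph0 ≤ κ) (H : HH κ)
    (hι : Cardinal.mk ι ≤ κ) (f : ι → ℕ → ℕ) :
    ∃ g : ℕ → ℕ, ∀ i, ∀ᶠ n in atTop, f i n ≤ g n := by
  obtain ⟨B, hB, hB2⟩ := build hι Set.Infinite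
    (fun i B => ∀ x ∈ B, ∀ y ∈ B, x < y → ∀ j ≤ x, f i j ≤ y)
    (fun S h1 h2 h3 => chain_inf hω H h1 h2 h3) (fun i C hC => sparse (f i) C hC)
  obtain ⟨A, hA, hA2⟩ := H (Set.range B)
    (dir_centered hB.dir (by rintro _ ⟨i, rfl⟩; exact (hB2 i).1))
    (Cardinal.mk_range_le.trans hι)
  have h1 : ∀ n k, ∃ x ∈ A n, k < x := fun n k => (hA n).exists_gt k
  choose s hs1 hs2 using h1
  refine ⟨fun k => (Finset.range (k+1)).sup fun n => s n (s n k), fun i => ?_⟩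
  obtain ⟨n, hn⟩ := hA2 _ ⟨i, rfl⟩
  obtain ⟨N, hN⟩ := hn.bddAbove
  have hmem : ∀ x ∈ A n, N < x → x ∈ B i := by
    intro x hx hNx
    by_contra hc
    have := hN ⟨hx, hc⟩
    omega
  filter_upwards [eventually_ge_atTop (max n N)] with k hk
  have hk1 := hs2 n k
  have hk2 := hs2 n (s n k)
  have h3 := (hB2 i).2 _ (hmem _ (hs1 n k) (by omega)) _ (hmem _ (hs1 n (s n k)) (by omega)) hk2 k
    hk1.le
  exact h3.trans (Finset.le_sup (f := fun n => s n (s n k)) (Finset.mem_range.2 (by omega)))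

lemma chain_pos {S 𝓕 : Set (Set ℕ)} {κ : Cardinal} (hω : Cardinal.aleph0 ≤ κ) (H : HH κ)
    (hF : Cardinal.mk 𝓕 ≤ κ) (hdir : ∀ X ∈ 𝓕, ∀ Y ∈ 𝓕, X ∩ Y ∈ 𝓕)
    (hinf : ∀ X ∈ 𝓕, X.Infinite)
    (hS : Cardinal.mk S ≤ κ) (hch : Chain S) (hQ : ∀ B ∈ S, Pos 𝓕 B) :
    ∃ C : Set ℕ, Pos 𝓕 C ∧ ∀ B ∈ S, AS C B := by
  rcases S.eq_empty_or_nonempty with rfl | hne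
  · exact ⟨Set.univ, fun F hF => by simpa using hinf F hF, by simp⟩
  by_cases hcc : CC S
  · obtain ⟨D, hD, hD2⟩ := hcc
    obtain ⟨C, hC, hC2⟩ := case1 (𝓕 := 𝓕) (fun f => dom hω H hF f) D
      (by rintro _ ⟨n, rfl⟩ _ ⟨m, rfl⟩; exact hch _ (hD n) _ (hD m)) (fun n => hQ _ (hD n))
    refine ⟨C, hC, fun B hB => ?_⟩
    obtain ⟨n, hn⟩ := hD2 B hB
    exact (hC2 n).trans hn
  · obtain ⟨A, hA, hA2⟩ := case2 hω H hF hS hdir hne hch hQ hcc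
    have h1 : ∀ (B : S) (n : ℕ), ∃ m, (∀ B ∈ S, AS (A n) B) → ∀ x ∈ A n \ B.1, x < m := by
      intro B n
      by_cases h : ∀ B ∈ S, AS (A n) B
      · obtain ⟨N, hN⟩ := (h B B.2).bddAbove
        exact ⟨N + 1, fun _ x hx => Nat.lt_succ_of_le (hN hx)⟩
      · exact ⟨0, fun h' => absurd h' h⟩
    choose f hf using h1
    obtain ⟨g, hg⟩ := dom hω H hS f
    refine ⟨{x | ∃ n, (∀ B ∈ S, AS (A n) B) ∧ x ∈ A n ∧ g n ≤ x}, ?_, ?_⟩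
    · intro F hF
      obtain ⟨n, h1, h2⟩ := hA2 F hF
      have h3 : AS (A n) {x | x ∈ A n ∧ g n ≤ x} := by
        refine (Set.finite_Iio (g n)).subset ?_
        rintro x ⟨hx, hc⟩
        by_contra h
        exact hc ⟨hx, by simpa using h⟩
      refine ((h3.inter h1).infinite (hA n)).mono ?_
      rintro x ⟨⟨hx, hx2⟩, hx3⟩
      exact ⟨⟨n, h2, hx, hx2⟩, hx3⟩
    · intro B hB
      obtain ⟨N, hN⟩ := Filter.eventually_atTop.1 (hg ⟨B, hB⟩)
      have hfin : (⋃ n ∈ {n | n < N ∧ ∀ B ∈ S, AS (A n) B}, A n \ B).Finite :=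
        Set.Finite.biUnion ((Set.finite_Iio N).subset fun n hn => hn.1) fun n hn => hn.2 B hB
      refine hfin.subset ?_
      rintro x ⟨⟨n, hn, hx, hgx⟩, hxB⟩
      refine Set.mem_biUnion ⟨?_, hn⟩ ⟨hx, hxB⟩
      by_contra hc
      have h4 := hN n (by omega)
      have h5 := hf ⟨B, hB⟩ n hn x ⟨hx, hxB⟩
      omega

lemma main_dir {𝓕 : Set (Set ℕ)} {κ : Cardinal} (hω : Cardinal.aleph0 ≤ κ) (H : HH κ)
    (hF : Cardinal.mk 𝓕 ≤ κ) (hdir : ∀ X ∈ 𝓕, ∀ Y ∈ 𝓕, X ∩ Y ∈ 𝓕)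
    (hinf : ∀ X ∈ 𝓕, X.Infinite) (hne : 𝓕.Nonempty) : ∃ A, IsPseudoIntersection A 𝓕 := by
  obtain ⟨B, hB, hB2⟩ := build (ι := 𝓕) hF (Pos 𝓕) (fun F B => B ⊆ F.1)
    (fun S h1 h2 h3 => chain_pos hω H hF hdir hinf h1 h2 h3)
    (fun F C hC => ⟨C ∩ F.1, Set.inter_subset_left, fun G hG => by
      rw [Set.inter_assoc]; exact hC _ (hdir _ F.2 _ hG), Set.inter_subset_right⟩)
  obtain ⟨C, hC, hC2⟩ := chain_pos hω H hF hdir hinf (Cardinal.mk_range_le.trans hF) hB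
    (by rintro _ ⟨F, rfl⟩; exact (hB2 F).1)
  obtain ⟨F, hF⟩ := hne
  exact ⟨C, (hC F hF).mono Set.inter_subset_left, fun G hG =>
    (hC2 _ ⟨⟨G, hG⟩, rfl⟩).trans (AS.of_subset (hB2 ⟨G, hG⟩).2)⟩

lemma main_centered {S : Set (Set ℕ)} (hS : IsCentered S) (H : HH (Cardinal.mk S)) :
    ∃ A, IsPseudoIntersection A S := by
  classical
  rcases S.eq_empty_or_nonempty with rfl | hne
  · exact ⟨Set.univ, Set.infinite_univ, by simp⟩
  by_cases hfin : S.Finite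
  · exact ⟨⋂₀ S, hS S le_rfl hfin hne, fun B hB => AS.of_subset (Set.sInter_subset_of_mem hB)⟩
  have hi : Infinite S := Set.infinite_coe_iff.2 hfin
  have hω : Cardinal.aleph0 ≤ Cardinal.mk S := Cardinal.infinite_iff.1 hi
  let φ : Finset S → Set ℕ := fun s => ⋂₀ (Subtype.val '' (s : Set S))
  obtain ⟨A, hA, hA2⟩ := main_dir (𝓕 := Set.range φ) hω H
    (Cardinal.mk_range_le.trans (Cardinal.mk_finset_of_infinite S).le)
    (by
      rintro _ ⟨s, rfl⟩ _ ⟨t, rfl⟩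
      refine ⟨s ∪ t, ?_⟩
      simp only [φ, Finset.coe_union, Set.image_union, Set.sInter_union])
    (by
      rintro _ ⟨s, rfl⟩
      rcases s.eq_empty_or_nonempty with rfl | h
      · simp [φ, Set.infinite_univ]
      · exact hS _ (by rintro _ ⟨x, _, rfl⟩; exact x.2) (s.finite_toSet.image _)
          (Set.Nonempty.image _ h))
    ⟨_, ⟨∅, rfl⟩⟩
  refine ⟨A, hA, fun B hB => ?_⟩
  have := hA2 _ ⟨{⟨B, hB⟩}, rfl⟩
  simpa only [φ, Finset.coe_singleton, Set.image_singleton, Set.sInter_singleton] using this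

end PS

/-- 𝔭_σ = 𝔭. -/
theorem statement7 : pSigmaNumber = pNumber := by
  have hsub : { c : Cardinal | ∃ ℱ : Set (Set ℕ), IsCentered ℱ ∧
      (∀ 𝒬 : ℕ → Set (Set ℕ), (⋃ n, 𝒬 n) = ℱ →
      ∃ n, ¬ ∃ A, IsPseudoIntersection A (𝒬 n)) ∧ Cardinal.mk ℱ = c } ⊆
      { c : Cardinal | ∃ ℱ : Set (Set ℕ), IsCentered ℱ ∧
      (¬ ∃ A, IsPseudoIntersection A ℱ) ∧ Cardinal.mk ℱ = c } := by
    rintro c ⟨S, h1, h2, h3⟩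
    refine ⟨S, h1, ?_, h3⟩
    obtain ⟨_, h⟩ := h2 (fun _ => S) (Set.iUnion_const S)
    exact h
  unfold pSigmaNumber pNumber
  rcases Set.eq_empty_or_nonempty { c : Cardinal | ∃ ℱ : Set (Set ℕ), IsCentered ℱ ∧
      (¬ ∃ A, IsPseudoIntersection A ℱ) ∧ Cardinal.mk ℱ = c } with he | hne
  · rw [he] at hsub ⊢
    rw [Set.subset_empty_iff.1 hsub]
  obtain ⟨S, h1, h2, h3⟩ := csInf_mem hne
  have hH : ¬ PS.HH (Cardinal.mk S) := fun H => h2 (PS.main_centered h1 H)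
  unfold PS.HH at hH
  push Not at hH
  obtain ⟨R, hR, hRc, hRs⟩ := hH
  have hmem : Cardinal.mk R ∈ { c : Cardinal | ∃ ℱ : Set (Set ℕ), IsCentered ℱ ∧
      (∀ 𝒬 : ℕ → Set (Set ℕ), (⋃ n, 𝒬 n) = ℱ →
      ∃ n, ¬ ∃ A, IsPseudoIntersection A (𝒬 n)) ∧ Cardinal.mk ℱ = c } := by
    refine ⟨R, hR, ?_, rfl⟩
    intro 𝒬 h𝒬
    by_contra hcon
    push Not at hcon
    choose A hA using hcon
    refine hRs ⟨A, fun n => (hA n).1, fun F hF => ?_⟩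
    rw [← h𝒬] at hF
    obtain ⟨n, hn⟩ := Set.mem_iUnion.1 hF
    exact ⟨n, (hA n).2 F hn⟩
  apply le_antisymm
  · rw [← h3]
    exact (csInf_le' hmem).trans hRc
  · exact csInf_le_csInf' ⟨_, hmem⟩ hsub
end

section
/- The minimal cardinality of a set X ⊆ ℝ such that C_p(X) does not have the Pytkeev property is equal to the pseudo-intersection number 𝔭. -/
open Set Topology Filter

/-- Almost inclusion of sets of naturals. -/
def AS (A B : Set ℕ) : Prop := (A \ B).Finite

lemma AS.trans {A B C : Set ℕ} (h : AS A B) (h' : AS B C) : AS A C := by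
  refine (h.union h').subset ?_
  intro x hx
  by_cases hB : x ∈ B
  · exact Or.inr ⟨hB, hx.2⟩
  · exact Or.inl ⟨hx.1, hB⟩

lemma AS.of_subset {A B : Set ℕ} (h : A ⊆ B) : AS A B := by
  unfold AS
  rw [Set.sdiff_eq_empty.2 h]
  exact Set.finite_empty

lemma infinite_exists_ge {A : Set ℕ} (h : A.Infinite) (n : ℕ) : ∃ a ∈ A, n ≤ a := by
  obtain ⟨a, ha, hn⟩ := h.exists_gt n
  exact ⟨a, ha, hn.le⟩

lemma infinite_of_exists_ge {A : Set ℕ} (h : ∀ n, ∃ a ∈ A, n ≤ a) : A.Infinite := by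
  apply Set.infinite_of_not_bddAbove
  rintro ⟨b, hb⟩
  obtain ⟨a, ha, hn⟩ := h (b + 1)
  have := hb ha
  omega

lemma infinite_of_AS {A B : Set ℕ} (h : A.Infinite) (h' : AS A B) : (A ∩ B).Infinite := by
  have := h.sdiff h'
  rwa [Set.sdiff_sdiff_right_self] at this

/-- Countable families with the strong finite intersection property have a pseudo-intersection. -/
lemma countable_pseudo (G : ℕ → Set ℕ) (h : ∀ n, (⋂ m ∈ Finset.range n, G m).Infinite) :
    ∃ P : Set ℕ, P.Infinite ∧ ∀ n, AS P (G n) := by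
  choose f hf hfn using fun n => infinite_exists_ge (h n) n
  refine ⟨Set.range f, ?_, ?_⟩
  · exact infinite_of_exists_ge fun n => ⟨f n, ⟨n, rfl⟩, hfn n⟩
  · intro n
    refine ((Finset.range (n+1)).finite_toSet.image f).subset ?_
    rintro x ⟨⟨m, rfl⟩, hx⟩
    refine ⟨m, ?_, rfl⟩
    by_contra hm
    apply hx
    have := hf m
    simp only [Set.mem_iInter, Finset.mem_range] at this
    apply this
    simp at hm
    omega

/-- Chains with respect to almost inclusion. -/
def IsCh {J : Type} (T : J → Set ℕ) : Prop := ∀ i j, AS (T i) (T j) ∨ AS (T j) (T i)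

lemma IsCh.fin {J : Type} {T : J → Set ℕ} (hT : IsCh T) [Nonempty J] (s : Finset J) :
    ∃ j0, ∀ j ∈ s, AS (T j0) (T j) := by
  classical
  induction s using Finset.induction_on with
  | empty => exact ⟨Classical.arbitrary J, by simp⟩
  | insert a s _ ih =>
    obtain ⟨j0, h0⟩ := ih
    rcases hT j0 a with h | h
    · refine ⟨j0, ?_⟩
      intro j hj
      rcases Finset.mem_insert.1 hj with rfl | hj
      · exact h
      · exact h0 j hj
    · refine ⟨a, ?_⟩
      intro j hj
      rcases Finset.mem_insert.1 hj with rfl | hj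
      · exact AS.of_subset subset_rfl
      · exact h.trans (h0 j hj)

lemma inter_inf_of_AS {J : Type} (T : J → Set ℕ) (s : Finset J) {B : Set ℕ} (hB : B.Infinite)
    (h : ∀ j ∈ s, AS B (T j)) : (B ∩ ⋂ j ∈ s, T j).Infinite := by
  apply infinite_of_AS hB
  have : (⋃ j ∈ s, (B \ T j)).Finite := s.finite_toSet.biUnion (fun j hj => h j hj)
  refine this.subset ?_
  rintro x ⟨hx, hx'⟩
  simp only [Set.mem_iInter, not_forall] at hx'
  obtain ⟨j, hj, hxj⟩ := hx'
  exact Set.mem_biUnion hj ⟨hx, hxj⟩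

/-- Every centered family of size at most `κ` has a countable pi-network of infinite sets. -/
def HK (κ : Cardinal.{0}) : Prop := ∀ (J : Type) (G : J → Set ℕ), Cardinal.mk J ≤ κ →
  (∀ s : Finset J, (⋂ j ∈ s, G j).Infinite) →
  ∃ A : ℕ → Set ℕ, (∀ n, (A n).Infinite) ∧ ∀ s : Finset J, ∃ n, A n ⊆ ⋂ j ∈ s, G j

/-- No towers of size at most `κ`. -/
lemma HK.tower {κ : Cardinal.{0}} (H : HK κ) {J : Type} (hJ : Cardinal.mk J ≤ κ) (T : J → Set ℕ)
    (hT : IsCh T) (hi : ∀ j, (T j).Infinite) : ∃ P : Set ℕ, P.Infinite ∧ ∀ j, AS P (T j) := by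
  rcases isEmpty_or_nonempty J with hE | hE
  · exact ⟨Set.univ, Set.infinite_univ, fun j => hE.elim j⟩
  have hc : ∀ s : Finset J, (⋂ j ∈ s, T j).Infinite := by
    intro s
    obtain ⟨j0, h0⟩ := hT.fin s
    exact (inter_inf_of_AS T s (hi j0) h0).mono Set.inter_subset_right
  obtain ⟨A, hA, hA'⟩ := H J T hJ hc
  by_cases hN : ∃ n, ∀ j, AS (A n) (T j)
  · obtain ⟨n, hn⟩ := hN
    exact ⟨A n, hA n, hn⟩
  push Not at hN
  choose t ht using hN
  have hcof : ∀ j, ∃ n, AS (T (t n)) (T j) := by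
    intro j
    obtain ⟨n, hn⟩ := hA' {j}
    refine ⟨n, ?_⟩
    rcases hT (t n) j with h | h
    · exact h
    · refine absurd (AS.trans (AS.of_subset ?_) h) (ht n)
      simpa using hn
  obtain ⟨P, hP, hP'⟩ := countable_pseudo (fun n => T (t n)) (by
    classical
    intro n
    refine (hc ((Finset.range n).image t)).mono ?_
    intro x hx
    simp only [Set.mem_iInter, Finset.mem_image, Finset.mem_range] at hx ⊢
    intro i hi
    exact hx _ ⟨i, hi, rfl⟩)
  refine ⟨P, hP, fun j => ?_⟩
  obtain ⟨n, hn⟩ := hcof j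
  exact (hP' n).trans hn

/-- Recursive construction of almost decreasing sequences. -/
lemma rec_chain {I : Type} [LinearOrder I] [WellFoundedLT I] (Q : Set ℕ → Prop)
    (R : I → Set ℕ → Prop)
    (step : ∀ i (T : Set.Iio i → Set ℕ), (∀ j, Q (T j)) → IsCh T →
      ∃ P, Q P ∧ R i P ∧ ∀ j, AS P (T j)) :
    ∃ T : I → Set ℕ, (∀ i, Q (T i) ∧ R i (T i)) ∧ IsCh T := by
  classical
  let Φ : ∀ i : I, (∀ j, j < i → Set ℕ) → Set ℕ := fun i T =>
    if h : ∃ P, Q P ∧ R i P ∧ ∀ j (hj : j < i), AS P (T j hj) then h.choose else ∅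
  let T : I → Set ℕ := (wellFounded_lt (α := I)).fix Φ
  have hTeq : ∀ i, T i = Φ i (fun j _ => T j) := fun i => WellFounded.fix_eq _ _ _
  have key : ∀ i, Q (T i) ∧ R i (T i) ∧ ∀ j, j < i → AS (T i) (T j) := by
    intro i
    induction i using (wellFounded_lt (α := I)).induction with
    | _ i ih =>
      have hex : ∃ P, Q P ∧ R i P ∧ ∀ j (hj : j < i), AS P (T j) := by
        obtain ⟨P, h1, h2, h3⟩ := step i (fun j => T j.1) (fun j => (ih j.1 j.2).1) (by
          intro a b
          rcases lt_trichotomy a.1 b.1 with h | h | h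
          · exact Or.inr ((ih b.1 b.2).2.2 _ h)
          · obtain rfl := Subtype.ext h
            exact Or.inl (AS.of_subset subset_rfl)
          · exact Or.inl ((ih a.1 a.2).2.2 _ h))
        exact ⟨P, h1, h2, fun j hj => h3 ⟨j, hj⟩⟩
      have : T i = hex.choose := by
        rw [hTeq i]
        exact dif_pos hex
      rw [this]
      exact hex.choose_spec
  refine ⟨T, fun i => ⟨(key i).1, (key i).2.1⟩, ?_⟩
  intro a b
  rcases lt_trichotomy a b with h | h | h
  · exact Or.inr ((key b).2.2 _ h)
  · rw [h]; exact Or.inl (AS.of_subset subset_rfl)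
  · exact Or.inl ((key a).2.2 _ h)

/-- Thinning out an infinite set. -/
lemma thin (P : Set ℕ) (hP : P.Infinite) (f : ℕ → ℕ) :
    ∃ T ⊆ P, T.Infinite ∧ ∀ a ∈ T, ∀ b ∈ T, a < b → ∀ k ≤ a, f k ≤ b := by
  choose nx hnx hnx' using fun n => infinite_exists_ge hP n
  let h : ℕ → ℕ := fun a => (∑ k ∈ Finset.range (a+1), f k) + a + 1
  let t : ℕ → ℕ := fun n => Nat.rec (nx 0) (fun _ a => nx (h a)) n
  have ht : ∀ n, h (t n) ≤ t (n+1) := fun n => hnx' _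
  have hlt : ∀ n, t n < t (n+1) := fun n => lt_of_lt_of_le (by simp only [h]; omega) (ht n)
  have hm : StrictMono t := strictMono_nat_of_lt_succ hlt
  refine ⟨Set.range t, ?_, Set.infinite_range_of_injective hm.injective, ?_⟩
  · rintro x ⟨n, rfl⟩
    cases n with
    | zero => exact hnx _
    | succ n => exact hnx _
  · rintro _ ⟨m, rfl⟩ _ ⟨n, rfl⟩ hab k hk
    have hmn : m < n := hm.lt_iff_lt.1 hab
    have h1 : t (m+1) ≤ t n := hm.monotone hmn
    have h2 : f k ≤ ∑ k ∈ Finset.range (t m+1), f k :=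
      Finset.single_le_sum (f := f) (fun _ _ => Nat.zero_le _) (by simp; omega)
    have h3 := ht m
    simp only [h] at h3
    omega

/-- Families of at most `κ` functions are bounded. -/
lemma HK.bdd {κ : Cardinal.{0}} (H : HK κ) {I : Type} (hI : Cardinal.mk I ≤ κ) (f : I → ℕ → ℕ) :
    ∃ g : ℕ → ℕ, ∀ i, ∃ N, ∀ n, N ≤ n → f i n ≤ g n := by
  obtain ⟨_, _⟩ := exists_wellFoundedLT I
  obtain ⟨T, hT, hch⟩ := rec_chain (I := I) (fun T => T.Infinite)
    (fun i T => ∀ a ∈ T, ∀ b ∈ T, a < b → ∀ k ≤ a, f i k ≤ b) (by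
      intro i T hT hch
      obtain ⟨P, hP, hP'⟩ := H.tower ((Cardinal.mk_set_le _).trans hI) T hch hT
      obtain ⟨S, hS, hSi, hS'⟩ := thin P hP (f i)
      exact ⟨S, hSi, hS', fun j => (AS.of_subset hS).trans (hP' j)⟩)
  obtain ⟨P, hP, hP'⟩ := H.tower hI T hch (fun i => (hT i).1)
  choose nx hnx hnx' using fun n => infinite_exists_ge hP n
  refine ⟨fun n => nx (nx n + 1), fun i => ?_⟩
  obtain ⟨b, hb⟩ := (hP' i).bddAbove
  have hmem : ∀ x ∈ P, b < x → x ∈ T i := by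
    intro x hx hbx
    by_contra hxT
    have := hb ⟨hx, hxT⟩
    omega
  refine ⟨b + 1, fun n hn => ?_⟩
  have h1 := hnx' n
  have h2 := hnx' (nx n + 1)
  exact (hT i).2 (nx n) (hmem _ (hnx _) (by omega)) (nx (nx n + 1)) (hmem _ (hnx _) (by omega))
    (by omega) n h1

/-- The key step: chains compatible with a directed family have compatible pseudo-intersections. -/
lemma HK.claim {κ : Cardinal.{0}} (hκ : Cardinal.aleph0 ≤ κ) (H : HK κ) {I J : Type} [Nonempty I]
    (hI : Cardinal.mk I ≤ κ) (hJ : Cardinal.mk J ≤ κ) (F : I → Set ℕ) (T : J → Set ℕ)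
    (hF : ∀ i, (F i).Infinite)
    (hdir : ∀ s : Finset I, ∃ k, ∀ i ∈ s, F k ⊆ F i)
    (hT : IsCh T) (hTF : ∀ j i, (T j ∩ F i).Infinite) :
    ∃ P : Set ℕ, (∀ i, (P ∩ F i).Infinite) ∧ ∀ j, AS P (T j) := by
  classical
  rcases isEmpty_or_nonempty J with hE | hE
  · exact ⟨Set.univ, fun i => by simpa using hF i, fun j => hE.elim j⟩
  have hcard : Cardinal.mk (J ⊕ I) ≤ κ := by
    rw [Cardinal.mk_sum, Cardinal.lift_id, Cardinal.lift_id]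
    exact Cardinal.add_le_of_le hκ hJ hI
  obtain ⟨A, hA, hA'⟩ := H (J ⊕ I) (Sum.elim T F) hcard (by
    intro s
    obtain ⟨j0, h0⟩ := hT.fin s.toLeft
    obtain ⟨i0, hi0⟩ := hdir s.toRight
    have := inter_inf_of_AS (Sum.elim T F) s (hTF j0 i0) (by
      rintro (j | i) hj
      · exact (AS.of_subset Set.inter_subset_left).trans (h0 j (by simpa using hj))
      · exact AS.of_subset (Set.inter_subset_right.trans (hi0 i (by simpa using hj))))
    exact this.mono Set.inter_subset_right)
  have hA2 : ∀ j i, ∃ n, A n ⊆ T j ∧ A n ⊆ F i := by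
    intro j i
    obtain ⟨n, hn⟩ := hA' {Sum.inl j, Sum.inr i}
    refine ⟨n, ?_, ?_⟩
    · intro x hx
      have := hn hx
      simp at this
      exact this.1
    · intro x hx
      have := hn hx
      simp at this
      exact this.2
  by_cases hN : ∀ i, ∃ n, (∀ j, AS (A n) (T j)) ∧ A n ⊆ F i
  · have hf : ∀ j n, ∃ b : ℕ, (∀ j, AS (A n) (T j)) → ∀ x ∈ A n, b ≤ x → x ∈ T j := by
      intro j n
      by_cases h : ∀ j, AS (A n) (T j)
      · obtain ⟨b, hb⟩ := (h j).bddAbove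
        refine ⟨b + 1, fun _ x hx hbx => ?_⟩
        by_contra hxT
        have := hb ⟨hx, hxT⟩
        omega
      · exact ⟨0, fun h' => absurd h' h⟩
    choose f hf using hf
    obtain ⟨g, hg⟩ := H.bdd hJ f
    refine ⟨{x | ∃ n, (∀ j, AS (A n) (T j)) ∧ x ∈ A n ∧ g n ≤ x}, ?_, ?_⟩
    · intro i
      obtain ⟨n, hn, hni⟩ := hN i
      apply infinite_of_exists_ge
      intro m
      obtain ⟨a, ha, ham⟩ := infinite_exists_ge (hA n) (max m (g n))
      exact ⟨a, ⟨⟨n, hn, ha, (le_max_right _ _).trans ham⟩, hni ha⟩, (le_max_left _ _).trans ham⟩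
    · intro j
      obtain ⟨N, hN'⟩ := hg j
      have hfin : (⋃ n ∈ {n | n < N ∧ ∀ j, AS (A n) (T j)}, (A n \ T j)).Finite := by
        apply Set.Finite.biUnion
        · exact (Set.finite_lt_nat N).subset fun n hn => hn.1
        · intro n hn
          exact hn.2 j
      refine hfin.subset ?_
      rintro x ⟨⟨n, hn, hx, hgx⟩, hxT⟩
      have hnN : n < N := by
        by_contra h
        exact hxT (hf j n hn x hx ((hN' n (by omega)).trans hgx))
      exact Set.mem_biUnion (show n ∈ {n | n < N ∧ ∀ j, AS (A n) (T j)} from ⟨hnN, hn⟩) ⟨hx, hxT⟩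
  · push Not at hN
    obtain ⟨i0, hi0⟩ := hN
    have ht : ∀ n, ∃ j, A n ⊆ F i0 → ¬ AS (A n) (T j) := by
      intro n
      by_cases h : ∀ j, AS (A n) (T j)
      · exact ⟨Classical.arbitrary J, fun h' => absurd h' (hi0 n h)⟩
      · push Not at h
        obtain ⟨j, hj⟩ := h
        exact ⟨j, fun _ => hj⟩
    choose t ht using ht
    have hcof : ∀ j, ∃ n, AS (T (t n)) (T j) := by
      intro j
      obtain ⟨n, hn, hn'⟩ := hA2 j i0
      refine ⟨n, ?_⟩
      rcases hT (t n) j with h | h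
      · exact h
      · exact absurd (AS.trans (AS.of_subset hn) h) (ht n hn')
    have hinf : ∀ i n, ∃ a, (∀ m ≤ n, a ∈ T (t m)) ∧ a ∈ F i ∧ n ≤ a := by
      intro i n
      obtain ⟨j0, h0⟩ := hT.fin ((Finset.range (n+1)).image t)
      have := inter_inf_of_AS T ((Finset.range (n+1)).image t) (hTF j0 i) (fun j hj =>
        (AS.of_subset Set.inter_subset_left).trans (h0 j hj))
      obtain ⟨a, ha, han⟩ := infinite_exists_ge this n
      refine ⟨a, ?_, ha.1.2, han⟩
      intro m hm
      have h2 := ha.2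
      simp only [Set.mem_iInter] at h2
      exact h2 _ (Finset.mem_image_of_mem _ (by simp; omega))
    choose f hf1 hf2 hf3 using hinf
    obtain ⟨g, hg⟩ := H.bdd hI f
    refine ⟨{x | ∃ n, x ≤ g n ∧ ∀ m ≤ n, x ∈ T (t m)}, ?_, ?_⟩
    · intro i
      obtain ⟨N, hN⟩ := hg i
      apply infinite_of_exists_ge
      intro m
      refine ⟨f i (max m N), ⟨⟨max m N, hN _ (le_max_right _ _), hf1 _ _⟩, hf2 _ _⟩, ?_⟩
      exact (le_max_left _ _).trans (hf3 _ _)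
    · intro j
      obtain ⟨m, hm⟩ := hcof j
      refine AS.trans ?_ hm
      have hfin : (⋃ n ∈ {n | n < m}, {x | x ≤ g n}).Finite :=
        (Set.finite_lt_nat m).biUnion fun n _ => Set.finite_le_nat _
      refine hfin.subset ?_
      rintro x ⟨⟨n, hn, hx⟩, hxT⟩
      refine Set.mem_biUnion (x := n) ?_ hn
      by_contra h
      simp at h
      exact hxT (hx m h)

/-- Under `HK κ` directed families of size at most `κ` have pseudo-intersections. -/
lemma HK.dir_pseudo {κ : Cardinal.{0}} (hκ : Cardinal.aleph0 ≤ κ) (H : HK κ) {I : Type}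
    [Nonempty I] (hI : Cardinal.mk I ≤ κ) (F : I → Set ℕ) (hF : ∀ i, (F i).Infinite)
    (hdir : ∀ s : Finset I, ∃ k, ∀ i ∈ s, F k ⊆ F i) :
    ∃ P : Set ℕ, P.Infinite ∧ ∀ i, AS P (F i) := by
  classical
  obtain ⟨_, _⟩ := exists_wellFoundedLT I
  obtain ⟨T, hT, hch⟩ := rec_chain (I := I) (fun T => ∀ i, (T ∩ F i).Infinite)
    (fun i T => T ⊆ F i) (by
      intro i T hT hch
      obtain ⟨P, hP, hP'⟩ := H.claim hκ hI ((Cardinal.mk_set_le _).trans hI) F T hF hdir hch hT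
      refine ⟨P ∩ F i, ?_, Set.inter_subset_right, fun j =>
        (AS.of_subset Set.inter_subset_left).trans (hP' j)⟩
      intro i'
      obtain ⟨k, hk⟩ := hdir {i, i'}
      refine (hP k).mono ?_
      rintro x ⟨hx, hxk⟩
      exact ⟨⟨hx, hk i (by simp) hxk⟩, hk i' (by simp) hxk⟩)
  obtain ⟨P, hP, hP'⟩ := H.tower hI T hch (fun i => ((hT i).1 i).mono Set.inter_subset_left)
  exact ⟨P, hP, fun i => (hP' i).trans (AS.of_subset (hT i).2)⟩

lemma HK.pseudo {κ : Cardinal.{0}} (hκ : Cardinal.aleph0 ≤ κ) (H : HK κ) (ℱ : Set (Set ℕ))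
    (hc : IsCentered ℱ) (hcard : Cardinal.mk ℱ ≤ κ) : ∃ A, IsPseudoIntersection A ℱ := by
  classical
  have hfin : Cardinal.mk (Finset ℱ) ≤ κ := by
    rcases finite_or_infinite ℱ with h | h
    · exact (Cardinal.lt_aleph0_of_finite _).le.trans hκ
    · rwa [Cardinal.mk_finset_of_infinite]
  obtain ⟨P, hP, hP'⟩ := H.dir_pseudo hκ hfin (fun s => ⋂ x ∈ s, (x : Set ℕ)) (by
    intro s
    rcases s.eq_empty_or_nonempty with rfl | hs
    · simpa using Set.infinite_univ
    · have := hc (Subtype.val '' (s : Set ℱ)) (by rintro _ ⟨x, _, rfl⟩; exact x.2)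
        (s.finite_toSet.image _) (by simpa using hs)
      refine this.mono ?_
      intro x hx
      simp only [Set.mem_iInter]
      intro y hy
      exact hx _ ⟨y, hy, rfl⟩) (by
    intro s
    refine ⟨s.biUnion id, ?_⟩
    intro i hi x hx
    simp only [Set.mem_iInter] at hx ⊢
    intro y hy
    exact hx y (Finset.mem_biUnion.2 ⟨i, hi, hy⟩))
  refine ⟨P, hP, fun B hB => ?_⟩
  have := hP' {⟨B, hB⟩}
  simpa [AS] using this

lemma countable_centered (ℱ : Set (Set ℕ)) (hc : IsCentered ℱ) (hcard : ℱ.Countable) :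
    ∃ A, IsPseudoIntersection A ℱ := by
  rcases ℱ.eq_empty_or_nonempty with rfl | hne
  · exact ⟨Set.univ, Set.infinite_univ, by simp⟩
  obtain ⟨G, rfl⟩ := hcard.exists_eq_range hne
  obtain ⟨P, hP, hP'⟩ := countable_pseudo G (by
    intro n
    refine (hc (G '' (Finset.range (n+1) : Set ℕ)) (Set.image_subset_range _ _)
      ((Finset.finite_toSet _).image _) ⟨G 0, 0, by simp, rfl⟩).mono ?_
    intro x hx
    simp only [Set.mem_iInter]
    intro m hm
    exact hx _ ⟨m, by simp at hm ⊢; omega, rfl⟩)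
  refine ⟨P, hP, ?_⟩
  rintro _ ⟨n, rfl⟩
  exact hP' n

lemma exists_bad : ∃ ℱ : Set (Set ℕ), IsCentered ℱ ∧ ¬ ∃ A, IsPseudoIntersection A ℱ := by
  refine ⟨{s | s ∈ Filter.hyperfilter ℕ}, ?_, ?_⟩
  · intro 𝒢 h𝒢 hfin _ hf
    have h1 : ⋂₀ 𝒢 ∈ Filter.hyperfilter ℕ := (Filter.sInter_mem hfin).2 h𝒢
    exact Filter.notMem_hyperfilter_of_finite hf h1
  · rintro ⟨A, hA, hA'⟩
    have : ∃ B ⊆ A, B.Infinite ∧ (A \ B).Infinite := by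
      obtain ⟨t, u, htu, hd, h1⟩ := hA.exists_union_disjoint_cardinal_eq_of_infinite
      have htu' : t.Infinite ↔ u.Infinite := by
        rw [← Set.infinite_coe_iff, Cardinal.infinite_iff, h1, ← Cardinal.infinite_iff,
          Set.infinite_coe_iff]
      have hor : t.Infinite ∨ u.Infinite := by
        rw [← Set.infinite_union, htu]
        exact hA
      have ht : t.Infinite := by tauto
      have hu : u.Infinite := by tauto
      refine ⟨t, htu ▸ Set.subset_union_left, ht, hu.mono ?_⟩
      intro x hx
      exact ⟨htu ▸ Or.inr hx, fun hxt => Set.disjoint_left.1 hd hxt hx⟩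
    obtain ⟨B, hB, hBi, hAB⟩ := this
    rcases Ultrafilter.mem_or_compl_mem (Filter.hyperfilter ℕ) B with h | h
    · exact hAB (hA' _ h)
    · have := hA' _ h
      rw [Set.sdiff_compl, Set.inter_eq_right.2 hB] at this
      exact hBi this

lemma p_nonempty : { c : Cardinal.{0} | ∃ ℱ : Set (Set ℕ), IsCentered ℱ ∧
    (¬ ∃ A, IsPseudoIntersection A ℱ) ∧ Cardinal.mk ℱ = c }.Nonempty := by
  obtain ⟨ℱ, h, h'⟩ := exists_bad
  exact ⟨_, ℱ, h, h', rfl⟩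

lemma p_attained : ∃ ℱ : Set (Set ℕ), IsCentered ℱ ∧
    (¬ ∃ A, IsPseudoIntersection A ℱ) ∧ Cardinal.mk ℱ = pNumber := csInf_mem p_nonempty

lemma lt_p (ℱ : Set (Set ℕ)) (hc : IsCentered ℱ) (h : Cardinal.mk ℱ < pNumber) :
    ∃ A, IsPseudoIntersection A ℱ := by
  by_contra hn
  exact notMem_of_lt_csInf' h ⟨ℱ, hc, hn, rfl⟩

lemma aleph0_lt_p : Cardinal.aleph0 < pNumber := by
  obtain ⟨ℱ, h1, h2, h3⟩ := p_attained
  rw [← h3]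
  by_contra h
  refine h2 (countable_centered ℱ h1 ?_)
  rw [not_lt, Cardinal.le_aleph0_iff_set_countable] at h
  exact h

/-- Countable tightness of `C_p(X)`. -/
lemma cp_tight (X : Set ℝ) (A : Set (Cp X)) (f : Cp X) (hf : f ∈ closure A) :
    ∃ B ⊆ A, B.Countable ∧ f ∈ closure B := by
  classical
  have key : ∀ k n : ℕ, ∃ B ⊆ A, B.Countable ∧ ∀ x : Fin k → X,
      ∃ g ∈ B, ∀ i, |g.1 (x i) - f.1 (x i)| < 1 / ((n : ℝ) + 1) := by
    intro k n
    obtain ⟨B, hB, hBc, hBu⟩ := TopologicalSpace.isOpen_biUnion_countable A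
      (fun g : Cp X => {x : Fin k → X | ∀ i, |g.1 (x i) - f.1 (x i)| < 1 / ((n : ℝ) + 1)}) (by
        intro g _
        simp only [Set.ofPred_forall]
        refine isOpen_iInter_of_finite fun i => ?_
        refine isOpen_lt ?_ continuous_const
        exact ((g.2.comp (continuous_apply i)).sub (f.2.comp (continuous_apply i))).abs)
    refine ⟨B, hB, hBc, fun x => ?_⟩
    have hx : x ∈ ⋃ g ∈ A, {x : Fin k → X | ∀ i, |g.1 (x i) - f.1 (x i)| < 1 / ((n : ℝ) + 1)} := by
      have hU : IsOpen {g : Cp X | ∀ i, |g.1 (x i) - f.1 (x i)| < 1 / ((n : ℝ) + 1)} := by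
        simp only [Set.ofPred_forall]
        refine isOpen_iInter_of_finite fun i => ?_
        refine isOpen_lt ?_ continuous_const
        exact (((continuous_apply (x i)).comp continuous_subtype_val).sub continuous_const).abs
      obtain ⟨g, hg, hgA⟩ := mem_closure_iff.1 hf _ hU (by
        intro i
        simp only [sub_self, abs_zero]
        positivity)
      exact Set.mem_biUnion hgA hg
    rw [← hBu] at hx
    simpa using hx
  choose B hB hBc hBx using key
  refine ⟨⋃ k, ⋃ n, B k n, Set.iUnion_subset fun k => Set.iUnion_subset fun n => hB k n,
    Set.countable_iUnion fun k => Set.countable_iUnion fun n => hBc k n, ?_⟩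
  rw [mem_closure_iff_nhds]
  intro U hU
  obtain ⟨V, hV, hVU⟩ := mem_nhds_subtype _ _ _ |>.1 hU
  rw [nhds_pi, Filter.mem_pi] at hV
  obtain ⟨s, hs, W, hW, hWV⟩ := hV
  have : ∃ n : ℕ, ∀ x ∈ s, Metric.ball (f.1 x) (1 / ((n : ℝ) + 1)) ⊆ W x := by
    have h1 : ∀ x, ∃ n : ℕ, Metric.ball (f.1 x) (1 / ((n : ℝ) + 1)) ⊆ W x := by
      intro x
      obtain ⟨n, _, hn⟩ := Metric.nhds_basis_ball_inv_nat_succ.mem_iff.1 (hW x)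
      exact ⟨n, hn⟩
    choose n hn using h1
    obtain ⟨M, hM⟩ := (hs.image n).bddAbove
    refine ⟨M, fun x hx => (Metric.ball_subset_ball ?_).trans (hn x)⟩
    have : n x ≤ M := hM ⟨x, hx, rfl⟩
    exact one_div_le_one_div_of_le (by positivity) (by exact_mod_cast Nat.succ_le_succ this)
  obtain ⟨n, hn⟩ := this
  let S := hs.toFinset
  obtain ⟨g, hg, hgx⟩ := hBx S.card n (fun i => (S.equivFin.symm i).1)
  refine ⟨g, hVU (hWV ?_), Set.mem_iUnion.2 ⟨_, Set.mem_iUnion.2 ⟨n, hg⟩⟩⟩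
  intro x hx
  have h1 := hgx (S.equivFin ⟨x, by simpa [S] using hx⟩)
  simp only [Equiv.symm_apply_apply] at h1
  exact hn x hx (by simpa [Real.dist_eq] using h1)

lemma pytkeev_of_lt (X : Set ℝ) (hX : Cardinal.mk X < pNumber) : PytkeevProp (Cp X) := by
  classical
  rintro A f ⟨hf, hfA⟩
  obtain ⟨B, hBA, hBc, hfB⟩ := cp_tight X A f hf
  have hfB' : f ∉ B := fun h => hfA (hBA h)
  have hinf : ∀ V ∈ 𝓝 f, (B ∩ V).Infinite := by
    intro V hV hfin
    have h1 : (B ∩ V)ᶜ ∈ 𝓝 f := hfin.isClosed.isOpen_compl.mem_nhds (fun h => hfB' h.1)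
    obtain ⟨g, hg, hgB⟩ := mem_closure_iff_nhds.1 hfB _ (Filter.inter_mem hV h1)
    exact hg.2 ⟨hgB, hg.1⟩
  have hBi : B.Infinite := (hinf Set.univ Filter.univ_mem).mono Set.inter_subset_left
  have := hBc.to_subtype
  have := hBi.to_subtype
  obtain ⟨_⟩ := nonempty_denumerable B
  let e : ℕ ≃ B := (Denumerable.eqv B).symm
  have hpre : ∀ V ∈ 𝓝 f, {n | (e n).1 ∈ V}.Infinite := by
    intro V hV hfin
    refine hinf V hV ((hfin.image fun n => (e n).1).subset ?_)
    rintro g ⟨hg, hgV⟩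
    exact ⟨e.symm ⟨g, hg⟩, by simpa using hgV, by simp⟩
  let G : X × ℕ → Set ℕ := fun p => {n | |(e n).1.1 p.1 - f.1 p.1| < 1 / ((p.2 : ℝ) + 1)}
  have hG : ∀ p : X × ℕ, {g : Cp X | |g.1 p.1 - f.1 p.1| < 1 / ((p.2 : ℝ) + 1)} ∈ 𝓝 f := by
    intro p
    refine IsOpen.mem_nhds (isOpen_lt ?_ continuous_const) ?_
    · exact (((continuous_apply p.1).comp continuous_subtype_val).sub continuous_const).abs
    · simp only [Set.mem_ofPred_eq, sub_self, abs_zero]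
      positivity
  obtain ⟨P, hP, hP'⟩ := lt_p (Set.range G) (by
    intro 𝒢 h𝒢 hfin _
    obtain ⟨s, hs, rfl⟩ := Set.exists_finite_iff_finset.1
      (Set.exists_subset_image_finite_and (p := fun t => t = 𝒢) (s := Set.univ) (f := G)
        |>.1 ⟨𝒢, by simpa using h𝒢, hfin, rfl⟩ |> fun ⟨s, _, hs, h⟩ => ⟨s, hs, h⟩)
    refine (hpre (⋂ p ∈ s, {g : Cp X | |g.1 p.1 - f.1 p.1| < 1 / ((p.2 : ℝ) + 1)})
      ((Filter.biInter_finset_mem s).2 fun p _ => hG p)).mono ?_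
    rintro n hn _ ⟨p, hp, rfl⟩
    simp only [Set.mem_ofPred_eq, Set.mem_iInter] at hn
    exact hn p hp) (by
    refine Cardinal.mk_range_le.trans_lt ?_
    rw [Cardinal.mk_prod, Cardinal.lift_id, Cardinal.lift_id, Cardinal.mk_nat]
    exact Cardinal.mul_lt_of_lt aleph0_lt_p.le hX aleph0_lt_p)
  have htend : Filter.Tendsto (fun n => (e n).1) (Filter.atTop ⊓ Filter.principal P) (𝓝 f) := by
    rw [tendsto_subtype_rng, tendsto_pi_nhds]
    intro x
    rw [Metric.tendsto_nhds]
    intro ε hε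
    obtain ⟨k, hk⟩ := exists_nat_one_div_lt hε
    rw [Filter.eventually_inf_principal]
    have h1 : (P \ G (x, k)).Finite := hP' _ ⟨_, rfl⟩
    obtain ⟨b, hb⟩ := h1.bddAbove
    filter_upwards [Filter.eventually_gt_atTop b] with n hn hnP
    by_contra h
    have : n ∉ G (x, k) := by
      intro h2
      apply h
      rw [Real.dist_eq]
      exact lt_trans h2 hk
    have := hb ⟨hnP, this⟩
    omega
  refine ⟨fun m => (fun n => (e n).1) '' {n | n ∈ P ∧ m ≤ n}, fun m => ⟨?_, ?_⟩, ?_⟩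
  · apply Set.Infinite.image
    · exact (Subtype.val_injective.comp e.injective).injOn
    · refine infinite_of_exists_ge fun n => ?_
      obtain ⟨a, ha, hn⟩ := infinite_exists_ge hP (max m n)
      exact ⟨a, ⟨ha, (le_max_left _ _).trans hn⟩, (le_max_right _ _).trans hn⟩
  · rintro _ ⟨n, _, rfl⟩
    exact hBA (e n).2
  · intro U hU
    have := htend hU
    rw [Filter.mem_map, Filter.mem_inf_principal, Filter.mem_atTop_sets] at this
    obtain ⟨m, hm⟩ := this
    refine ⟨m, ?_⟩
    rintro _ ⟨n, hn, rfl⟩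
    exact hm n hn.2 hn.1

/-- If all small `C_p(X)` are Pytkeev then small centered families have countable pi-networks. -/
lemma HK_of_pytkeev (κ : Cardinal.{0}) (h : ∀ X : Set ℝ, Cardinal.mk X ≤ κ → PytkeevProp (Cp X)) :
    HK κ := by
  classical
  intro J G hJ hG
  rcases isEmpty_or_nonempty J with hE | hE
  · exact ⟨fun _ => Set.univ, fun _ => Set.infinite_univ, fun s => ⟨0, by
      intro x _
      simp only [Set.mem_iInter]
      exact fun j => hE.elim j⟩⟩
  obtain ⟨φ, -, hφc, hφi⟩ := Perfect.exists_nat_bool_injection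
    (C := (Set.univ : Set ℝ)) (PerfectSpace.univ_perfect ℝ) Set.univ_nonempty
  have hemb : IsEmbedding φ := (hφc.isClosedEmbedding hφi).isEmbedding
  let c : J → ℕ → Bool := fun j n => decide (n ∈ G j)
  let X : Set ℝ := Set.range (fun j => φ (c j))
  let r : X → (ℕ → Bool) := fun x => (Equiv.ofInjective φ hφi).symm
    ⟨x.1, by obtain ⟨j, hj⟩ := x.2; exact ⟨_, hj⟩⟩
  have hr : Continuous r := by
    rw [hemb.continuous_iff]
    have : φ ∘ r = Subtype.val := by
      funext x
      exact Equiv.apply_ofInjective_symm hφi _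
    rw [this]
    exact continuous_subtype_val
  let pt : J → X := fun j => ⟨φ (c j), j, rfl⟩
  have hpt : ∀ j, r (pt j) = c j := fun j => Equiv.ofInjective_symm_apply hφi (c j)
  let F : ℕ → Cp X := fun n => ⟨fun x => (if r x n = true then (0:ℝ) else 1) + 1 / ((n:ℝ) + 1), by
    refine Continuous.add ?_ continuous_const
    exact (continuous_of_discreteTopology (f := fun b : Bool => if b = true then (0:ℝ) else 1)).comp
      ((continuous_apply n).comp hr)⟩
  have hFpt : ∀ n j, (F n).1 (pt j) = (if n ∈ G j then (0:ℝ) else 1) + 1 / ((n:ℝ) + 1) := by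
    intro n j
    simp only [F, hpt, c, decide_eq_true_eq]
  let zero : Cp X := ⟨fun _ => 0, continuous_const⟩
  have hXc : Cardinal.mk X ≤ κ := Cardinal.mk_range_le.trans hJ
  have hsurj : ∀ x : X, ∃ j, pt j = x := by
    rintro ⟨_, j, rfl⟩
    exact ⟨j, rfl⟩
  choose idx hidx using hsurj
  obtain ⟨𝒜, h𝒜, h𝒜'⟩ := h X hXc (Set.range F) zero ⟨by
    rw [mem_closure_iff_nhds]
    intro U hU
    obtain ⟨V, hV, hVU⟩ := mem_nhds_subtype _ _ _ |>.1 hU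
    rw [nhds_pi, Filter.mem_pi] at hV
    obtain ⟨s, hs, W, hW, hWV⟩ := hV
    have hev : ∀ᶠ n : ℕ in Filter.atTop, ∀ x ∈ s, 1 / ((n:ℝ) + 1) ∈ W x := by
      rw [Filter.eventually_all_finite hs]
      intro x _
      exact tendsto_one_div_add_atTop_nhds_zero_nat (hW x)
    obtain ⟨N, hN⟩ := Filter.eventually_atTop.1 hev
    obtain ⟨n, hn, hnN⟩ := infinite_exists_ge (hG (hs.toFinset.image idx)) N
    refine ⟨F n, hVU (hWV ?_), n, rfl⟩
    intro x hx
    have h1 : n ∈ G (idx x) := by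
      simp only [Set.mem_iInter] at hn
      exact hn _ (Finset.mem_image_of_mem _ (by simpa using hx))
    have h2 := hFpt n (idx x)
    rw [hidx, if_pos h1, zero_add] at h2
    rw [h2]
    exact hN n hnN x hx, by
    rintro ⟨n, hn⟩
    have h1 := hFpt n (Classical.arbitrary J)
    rw [hn] at h1
    have h2 : (0:ℝ) < 1 / ((n:ℝ) + 1) := by positivity
    have h3 : (0:ℝ) = (if n ∈ G (Classical.arbitrary J) then (0:ℝ) else 1) + 1 / ((n:ℝ) + 1) := h1
    split_ifs at h3 <;> linarith⟩
  refine ⟨fun k => {n | F n ∈ 𝒜 k}, fun k hfin => (h𝒜 k).1 ((hfin.image F).subset ?_), fun s => ?_⟩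
  · intro g hg
    obtain ⟨n, rfl⟩ := (h𝒜 k).2 hg
    exact ⟨n, hg, rfl⟩
  · obtain ⟨k, hk⟩ := h𝒜' (⋂ j ∈ s, {g : Cp X | g.1 (pt j) < 1}) (by
      refine (Filter.biInter_finset_mem s).2 fun j _ => ?_
      refine IsOpen.mem_nhds (isOpen_lt ?_ continuous_const) ?_
      · exact (continuous_apply (pt j)).comp continuous_subtype_val
      · exact (zero_lt_one : (0:ℝ) < 1))
    refine ⟨k, fun n hn => ?_⟩
    have h1 := hk hn
    simp only [Set.mem_iInter, Set.mem_ofPred_eq] at h1 ⊢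
    intro j hj
    by_contra hnj
    have h2 := h1 j hj
    rw [hFpt, if_neg hnj] at h2
    have h3 : (0:ℝ) < 1 / ((n:ℝ) + 1) := by positivity
    linarith

lemma exists_bad_X : ∃ X : Set ℝ, ¬ PytkeevProp (Cp X) ∧ Cardinal.mk X ≤ pNumber := by
  by_contra hcon
  push Not at hcon
  have H : HK pNumber := HK_of_pytkeev _ fun X hX => by
    by_contra h
    exact absurd hX (not_le.2 (hcon X h))
  obtain ⟨ℱ, h1, h2, h3⟩ := p_attained
  exact h2 (H.pseudo aleph0_lt_p.le ℱ h1 h3.le)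

/-- the minimal cardinality of a set `X ⊆ ℝ` such that `C_p(X)`
does not have the Pytkeev property equals 𝔭. -/
theorem statement8 :
    sInf { c : Cardinal | ∃ X : Set ℝ, ¬ PytkeevProp (Cp X) ∧ Cardinal.mk X = c }
      = pNumber := by
  obtain ⟨X, hX, hXc⟩ := exists_bad_X
  apply le_antisymm
  · refine le_trans (csInf_le' ?_) hXc
    exact ⟨X, hX, rfl⟩
  · refine le_csInf ⟨_, X, hX, rfl⟩ ?_
    rintro _ ⟨Y, hY, rfl⟩
    by_contra h
    exact hY (pytkeev_of_lt Y (not_le.1 h))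
end

section
/- For every set X ⊆ ℝ whose cardinality is strictly less than 𝔭, the space C_p(X) has the Pytkeev property. -/
open Set Topology Filter

theorem nhds_Cp_basis {Z : Type*} [TopologicalSpace Z] (y : Cp Z) (U : Set (Cp Z))
    (hU : U ∈ nhds y) : ∃ (s : Finset Z) (k : ℕ),
      {f : Cp Z | ∀ x ∈ s, |f.1 x - y.1 x| < 1 / ((k : ℝ) + 1)} ⊆ U := by
  obtain ⟨V, hV, hVU⟩ := (mem_nhds_induced _ _ _).1 hU
  rw [nhds_pi, Filter.mem_pi] at hV
  obtain ⟨I, hI, t, ht, htV⟩ := hV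
  have h1 : ∀ i, ∃ k : ℕ, Metric.ball (y.1 i) (1 / ((k : ℝ) + 1)) ⊆ t i := by
    intro i
    obtain ⟨k, _, hk⟩ := (Metric.nhds_basis_ball_inv_nat_succ (x := y.1 i)).mem_iff.1 (ht i)
    exact ⟨k, hk⟩
  choose k hk using h1
  refine ⟨hI.toFinset, hI.toFinset.sup k, fun f hf => hVU (htV ?_)⟩
  intro i hi
  apply hk i
  rw [Metric.mem_ball, Real.dist_eq]
  refine (hf i (by simpa using hi)).trans_le ?_
  have : k i ≤ hI.toFinset.sup k := Finset.le_sup (f := k) (by simpa using hi)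
  have : (k i : ℝ) ≤ (hI.toFinset.sup k : ℕ) := by exact_mod_cast this
  apply one_div_le_one_div_of_le <;> [positivity; linarith]

theorem sub_nhds_Cp {Z : Type*} [TopologicalSpace Z] (y : Cp Z) (x : Z) (k : ℕ) :
    {f : Cp Z | |f.1 x - y.1 x| < 1 / ((k : ℝ) + 1)} ∈ nhds y := by
  have hc : Continuous fun f : Cp Z => |f.1 x - y.1 x| :=
    (((continuous_apply x).comp continuous_subtype_val).sub continuous_const).abs
  apply (isOpen_lt hc continuous_const).mem_nhds
  simp only [mem_setOf_eq, sub_self, abs_zero]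
  positivity

theorem Cp_tight {Z : Type*} [TopologicalSpace Z] [SecondCountableTopology Z]
    (A : Set (Cp Z)) (y : Cp Z) (hy : y ∈ closure A) :
    ∃ B ⊆ A, B.Countable ∧ y ∈ closure B := by
  have key : ∀ p : ℕ × ℕ, ∃ T : Set A, T.Countable ∧
      ∀ x : Fin p.1 → Z, ∃ a ∈ T, ∀ i, |a.1.1 (x i) - y.1 (x i)| < 1 / ((p.2 : ℝ) + 1) := by
    rintro ⟨n, k⟩
    let O : A → Set (Fin n → Z) := fun a =>
      {x | ∀ i, |a.1.1 (x i) - y.1 (x i)| < 1 / ((k : ℝ) + 1)}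
    have hO : ∀ a, IsOpen (O a) := by
      intro a
      have : O a = ⋂ i, {x | |a.1.1 (x i) - y.1 (x i)| < 1 / ((k : ℝ) + 1)} := by
        ext x; simp [O]
      rw [this]
      refine isOpen_iInter_of_finite fun i => isOpen_lt ?_ continuous_const
      exact ((a.1.2.comp (continuous_apply i)).sub (y.2.comp (continuous_apply i))).abs
    obtain ⟨T, hT, hTU⟩ := TopologicalSpace.isOpen_iUnion_countable O hO
    refine ⟨T, hT, fun x => ?_⟩
    have hx : x ∈ ⋃ a, O a := by
      have hN : (⋂ i, {f : Cp Z | |f.1 (x i) - y.1 (x i)| < 1 / ((k : ℝ) + 1)}) ∈ nhds y :=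
        Filter.iInter_mem.2 fun i => sub_nhds_Cp y (x i) k
      obtain ⟨a, ha, haA⟩ := mem_closure_iff_nhds.1 hy _ hN
      exact mem_iUnion.2 ⟨⟨a, haA⟩, fun i => mem_iInter.1 ha i⟩
    rw [← hTU] at hx
    simp only [mem_iUnion] at hx
    obtain ⟨a, haT, ha⟩ := hx
    exact ⟨a, haT, ha⟩
  choose T hT hT2 using key
  refine ⟨⋃ p, Subtype.val '' T p, ?_, countable_iUnion fun p => (hT p).image _, ?_⟩
  · refine iUnion_subset fun p => ?_
    rintro _ ⟨a, _, rfl⟩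
    exact a.2
  · rw [mem_closure_iff_nhds]
    intro U hU
    obtain ⟨s, k, hs⟩ := nhds_Cp_basis y U hU
    obtain ⟨a, ha, h⟩ := hT2 (s.card, k) (fun i => (s.equivFin.symm i).1)
    refine ⟨a.1, hs ?_, mem_iUnion.2 ⟨_, a, ha, rfl⟩⟩
    intro x hx
    simpa using h (s.equivFin ⟨x, hx⟩)

theorem inf_of_closure {Y : Type*} [TopologicalSpace Y] [T1Space Y] {A : Set Y} {y : Y}
    (hy : y ∈ closure A) (hyA : y ∉ A) {U : Set Y} (hU : U ∈ nhds y) : (U ∩ A).Infinite := by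
  intro hfin
  have h1 : (U ∩ A)ᶜ ∈ nhds y := hfin.isClosed.isOpen_compl.mem_nhds fun h => hyA h.2
  obtain ⟨a, ha, haA⟩ := mem_closure_iff_nhds.1 hy _ (inter_mem hU h1)
  exact ha.2 ⟨ha.1, haA⟩

/-- if `X ⊆ ℝ` and `|X| < 𝔭`, then `C_p(X)` has the Pytkeev
property. -/
theorem statement9 (X : Set ℝ) (hcard : Cardinal.mk X < pNumber) :
    PytkeevProp (Cp X) := by
  rintro A y ⟨hy, hyA⟩
  rcases finite_or_infinite X with hX | hX
  · have : FirstCountableTopology (Cp X) :=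
      Topology.IsInducing.subtypeVal.firstCountableTopology
    obtain ⟨u, hu⟩ := (nhds y).exists_antitone_basis
    refine ⟨fun n => u n ∩ A, fun n => ⟨inf_of_closure hy hyA (hu.mem n), inter_subset_right⟩, ?_⟩
    intro U hU
    obtain ⟨n, hn⟩ := hu.mem_iff.1 hU
    exact ⟨n, inter_subset_left.trans hn⟩
  obtain ⟨B, hBA, hBc, hyB⟩ := Cp_tight A y hy
  have hyB' : y ∉ B := fun h => hyA (hBA h)
  have hBinf : B.Infinite := by simpa using inf_of_closure hyB hyB' univ_mem
  have : Infinite B := hBinf.to_subtype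
  have : Countable B := hBc.to_subtype
  obtain ⟨e⟩ := nonempty_equiv_of_countable (α := ℕ) (β := B)
  let F : X × ℕ → Set ℕ := fun p => {n | |(e n).1.1 p.1 - y.1 p.1| < 1 / ((p.2 : ℝ) + 1)}
  have hpre : ∀ U ∈ nhds y, {n | (e n).1 ∈ U}.Infinite := by
    intro U hU hfin
    refine inf_of_closure hyB hyB' hU ((hfin.image fun n => (e n).1).subset ?_)
    rintro b ⟨hbU, hbB⟩
    exact ⟨e.symm ⟨b, hbB⟩, by simpa using hbU, by simp⟩
  have hcent : IsCentered (range F) := by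
    intro G hG hGf _
    have hG' : ∀ g, ∃ p : X × ℕ, g ∈ G → F p = g := by
      intro g
      by_cases hg : g ∈ G
      · obtain ⟨p, hp⟩ := hG hg
        exact ⟨p, fun _ => hp⟩
      · exact ⟨(Classical.arbitrary X, 0), fun h => absurd h hg⟩
    choose p hp using hG'
    have hN : (⋂ g ∈ G, {f : Cp X | |f.1 (p g).1 - y.1 (p g).1| < 1 / (((p g).2 : ℝ) + 1)})
        ∈ nhds y := (Filter.biInter_mem hGf).2 fun g _ => sub_nhds_Cp y _ _
    refine (hpre _ hN).mono ?_
    intro n hn g hg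
    rw [← hp g hg]
    exact mem_iInter₂.1 hn g hg
  have hlt : Cardinal.mk (range F) < pNumber := by
    refine lt_of_le_of_lt (Cardinal.mk_range_le.trans ?_) hcard
    rw [Cardinal.mk_prod]
    simp
  have hex : ∃ P, IsPseudoIntersection P (range F) := by
    by_contra h
    exact absurd hlt (not_lt.2 (csInf_le' ⟨range F, hcent, h, rfl⟩))
  obtain ⟨P, hPinf, hP⟩ := hex
  refine ⟨fun n => (fun m => (e m).1) '' (P \ Iio n), fun n => ⟨?_, ?_⟩, ?_⟩
  · exact (hPinf.diff (finite_Iio n)).image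
      ((Subtype.val_injective.comp e.injective).injOn)
  · rintro _ ⟨m, _, rfl⟩
    exact hBA (e m).2
  · intro U hU
    obtain ⟨s, k, hs⟩ := nhds_Cp_basis y U hU
    have hfin : (⋃ x ∈ s, P \ F (x, k)).Finite :=
      s.finite_toSet.biUnion fun x _ => hP _ ⟨_, rfl⟩
    obtain ⟨N, hN⟩ := hfin.bddAbove
    refine ⟨N + 1, ?_⟩
    rintro _ ⟨m, ⟨hmP, hm⟩, rfl⟩
    apply hs
    intro x hx
    by_contra hcon
    have : m ≤ N := hN (mem_iUnion₂.2 ⟨x, hx, hmP, hcon⟩)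
    exact hm (by simp only [mem_Iio]; omega)
end

section
/- For every topological space X, the following are equivalent: (1) C_p(X,{0,1}) has the Pytkeev property; (2) every clopen ω-cover of X contains a countable ω-cover of X, and for every continuous map Ψ : X → [ℕ]^ω whose image ℱ is free (⋂ℱ = ∅) and centered, there is a partition ⟨ℱ⟩ = ⋃_{n∈ℕ} ℱₙ of the closure ⟨ℱ⟩ of ℱ under finite intersections such that each ℱₙ has a pseudo-intersection; (3) every clopen ω-cover 𝒰 of X contains infinite subsets 𝒰₁, 𝒰₂, … such that the family {⋂𝒰ₙ : n ∈ ℕ} is an ω-cover of X. -/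
open Set Topology Filter

theorem exists_fin_image {α β : Type*} (f : α → β) (t : Set β) (h : t ⊆ range f) (ht : t.Finite) :
    ∃ s : Set α, True ∧ s.Finite ∧ f '' s = t := by
  rcases isEmpty_or_nonempty α with hα | hα
  · refine ⟨∅, trivial, finite_empty, ?_⟩
    rw [range_eq_empty, subset_empty_iff] at h
    rw [h, image_empty]
  choose! g hg using fun y (hy : y ∈ t) => h hy
  refine ⟨g '' t, trivial, ht.image g, ?_⟩
  rw [image_image]
  exact (image_congr hg).trans (image_id' t)

theorem omega_inf {X : Type*} {𝒰 : Set (Set X)} (h : IsOmegaCover 𝒰) (F : Set X) (hF : F.Finite) :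
    {U ∈ 𝒰 | F ⊆ U}.Infinite := by
  intro hfin
  have hx : ∀ U : Set X, U ∈ {U ∈ 𝒰 | F ⊆ U} → ∃ x, x ∉ U := by
    intro U hU
    by_contra hc
    push Not at hc
    exact h.1 (eq_univ_of_forall hc ▸ hU.1)
  have hne : Nonempty X := by
    obtain ⟨U, hU, hFU⟩ := h.2 F hF
    obtain ⟨x, -⟩ := hx U ⟨hU, hFU⟩
    exact ⟨x⟩
  choose! g hg using hx
  obtain ⟨V, hV, hsub⟩ := h.2 (F ∪ g '' {U ∈ 𝒰 | F ⊆ U}) (hF.union (hfin.image g))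
  have hV' : V ∈ {U ∈ 𝒰 | F ⊆ U} := ⟨hV, subset_union_left.trans hsub⟩
  exact hg V hV' (hsub (Or.inr ⟨V, hV', rfl⟩))

theorem sInter_ne_univ {X : Type*} {𝒰 : Set (Set X)} (h : IsOmegaCover 𝒰) (𝒱 : Set (Set X))
    (hs : 𝒱 ⊆ 𝒰) (hi : 𝒱.Infinite) : ⋂₀ 𝒱 ≠ univ := by
  intro he
  obtain ⟨U, hU⟩ := hi.nonempty
  have : U = univ := univ_subset_iff.1 (he ▸ sInter_subset_of_mem hU)
  exact h.1 (this ▸ hs hU)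

theorem isOpen_near {X : Type*} [TopologicalSpace X] (y : CpS X ({0, 1} : Set ℝ)) (F : Set X)
    (hF : F.Finite) : {f : CpS X ({0, 1} : Set ℝ) | ∀ x ∈ F, f.1 x = y.1 x} ∈ nhds y := by
  have h1 : ∀ x ∈ F, ∀ᶠ f : CpS X ({0, 1} : Set ℝ) in nhds y, f.1 x = y.1 x := by
    intro x _
    have hc : Continuous (fun f : CpS X ({0, 1} : Set ℝ) => f.1 x) :=
      (continuous_apply x).comp continuous_subtype_val
    have := hc.continuousAt.eventually (Metric.ball_mem_nhds (y.1 x) (zero_lt_one))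
    filter_upwards [this] with f hf
    have a := f.2.2 x
    have b := y.2.2 x
    simp only [mem_insert_iff, mem_singleton_iff] at a b
    rw [Real.dist_eq] at hf
    rcases a with a | a <;> rcases b with b | b <;> rw [a, b] at hf ⊢ <;> norm_num at hf
  exact (Filter.eventually_all_finite hF).2 h1

theorem near_sub {X : Type*} [TopologicalSpace X] (y : CpS X ({0, 1} : Set ℝ))
    (U : Set (CpS X ({0, 1} : Set ℝ))) (hU : U ∈ nhds y) :
    ∃ F : Set X, F.Finite ∧ ∀ f : CpS X ({0, 1} : Set ℝ), (∀ x ∈ F, f.1 x = y.1 x) → f ∈ U := by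
  rw [nhds_induced, Filter.mem_comap] at hU
  obtain ⟨t, ht, htU⟩ := hU
  rw [nhds_pi, Filter.mem_pi] at ht
  obtain ⟨I, hI, s, hs, hst⟩ := ht
  refine ⟨I, hI, fun f hf => htU (hst ?_)⟩
  intro x hx
  rw [hf x hx]
  exact mem_of_mem_nhds (hs x)

theorem clopen_eq {X : Type*} [TopologicalSpace X] (f y : CpS X ({0, 1} : Set ℝ)) :
    IsClopen {x | f.1 x = y.1 x} := by
  refine ⟨isClosed_eq f.2.1 y.2.1, ?_⟩
  have : {x | f.1 x = y.1 x} = {x | |f.1 x - y.1 x| < 1} := by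
    ext x
    have a := f.2.2 x
    have b := y.2.2 x
    simp only [mem_insert_iff, mem_singleton_iff] at a b
    rcases a with a | a <;> rcases b with b | b <;> simp [a, b]
  rw [this]
  exact isOpen_lt (f.2.1.sub y.2.1).abs continuous_const

theorem eq_inj {X : Type*} [TopologicalSpace X] (y : CpS X ({0, 1} : Set ℝ)) :
    Function.Injective (fun f : CpS X ({0, 1} : Set ℝ) => {x | f.1 x = y.1 x}) := by
  intro f g h
  apply Subtype.ext
  funext x
  have hx : f.1 x = y.1 x ↔ g.1 x = y.1 x := by
    have := congrArg (fun s : Set X => x ∈ s) h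
    simpa using this
  have a := f.2.2 x
  have b := y.2.2 x
  have c := g.2.2 x
  simp only [mem_insert_iff, mem_singleton_iff] at a b c
  rcases a with a | a <;> rcases b with b | b <;> rcases c with c | c <;> simp_all

theorem exists_ind {X : Type*} [TopologicalSpace X] (U : Set X) (hU : IsClopen U) :
    ∃ f : CpS X ({0, 1} : Set ℝ), {x | f.1 x = 1} = U := by
  classical
  refine ⟨⟨U.indicator (fun _ => (1 : ℝ)), continuous_const.indicator (by simp [hU.frontier_eq]), ?_⟩, ?_⟩
  · intro x
    by_cases h : x ∈ U <;> simp [h]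
  · ext x
    by_cases h : x ∈ U <;> simp [h]

def SelProp (X : Type*) [TopologicalSpace X] : Prop :=
  ∀ 𝒰 : Set (Set X), (∀ U ∈ 𝒰, IsClopen U) → IsOmegaCover 𝒰 →
        ∃ 𝒱 : ℕ → Set (Set X), (∀ n, 𝒱 n ⊆ 𝒰 ∧ (𝒱 n).Infinite) ∧
          IsOmegaCover (Set.range fun n => ⋂₀ 𝒱 n)

theorem pyt_iff_sel (X : Type*) [TopologicalSpace X] :
    PytkeevProp (CpS X ({0, 1} : Set ℝ)) ↔ SelProp X := by
  constructor
  · intro h 𝒰 hcl hom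
    let y : CpS X ({0, 1} : Set ℝ) := ⟨fun _ => 1, continuous_const, fun _ => by simp⟩
    let e : CpS X ({0, 1} : Set ℝ) → Set X := fun f => {x | f.1 x = y.1 x}
    have he : Function.Injective e := eq_inj y
    obtain ⟨𝒜, h1, h2⟩ := h (e ⁻¹' 𝒰) y (by
      refine ⟨?_, ?_⟩
      · rw [mem_closure_iff_nhds]
        intro W hW
        obtain ⟨F, hF, hFW⟩ := near_sub y W hW
        obtain ⟨U, hU, hFU⟩ := hom.2 F hF
        obtain ⟨f, hf⟩ := exists_ind U (hcl U hU)
        have hef : e f = U := hf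
        refine ⟨f, hFW f fun x hx => ?_, ?_⟩
        · have : x ∈ e f := hef ▸ hFU hx
          exact this
        · rw [mem_preimage, hef]; exact hU
      · intro hy
        apply hom.1
        have : e y = univ := eq_univ_of_forall fun x => rfl
        rw [← this]; exact hy)
    have hsel : ∀ n, e '' 𝒜 n ⊆ 𝒰 ∧ (e '' 𝒜 n).Infinite := fun n =>
      ⟨image_subset_iff.2 (h1 n).2, (h1 n).1.image he.injOn⟩
    refine ⟨fun n => e '' 𝒜 n, hsel, ?_, ?_⟩
    · rintro ⟨n, hn⟩
      exact sInter_ne_univ hom _ (hsel n).1 (hsel n).2 hn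
    · intro F hF
      obtain ⟨n, hn⟩ := h2 _ (isOpen_near y F hF)
      refine ⟨_, ⟨n, rfl⟩, ?_⟩
      rintro x hx _ ⟨f, hf, rfl⟩
      exact hn hf x hx
  · intro h A y hy
    let e : CpS X ({0, 1} : Set ℝ) → Set X := fun f => {x | f.1 x = y.1 x}
    have he : Function.Injective e := eq_inj y
    obtain ⟨𝒱, h1, h2⟩ := h (e '' A) (by rintro _ ⟨f, _, rfl⟩; exact clopen_eq f y) (by
      refine ⟨?_, ?_⟩
      · rintro ⟨f, hf, hfe⟩
        have : e y = univ := eq_univ_of_forall fun x => rfl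
        exact hy.2 (he (hfe.trans this.symm) ▸ hf)
      · intro F hF
        obtain ⟨f, hf, hfA⟩ := mem_closure_iff_nhds.1 hy.1 _ (isOpen_near y F hF)
        exact ⟨e f, ⟨f, hfA, rfl⟩, hf⟩)
    refine ⟨fun n => A ∩ e ⁻¹' 𝒱 n, fun n => ⟨?_, inter_subset_left⟩, ?_⟩
    · have : e '' (A ∩ e ⁻¹' 𝒱 n) = 𝒱 n := by
        rw [image_inter_preimage]
        exact inter_eq_right.2 (h1 n).1
      refine Set.Infinite.of_image e ?_
      rw [this]; exact (h1 n).2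
    · intro U hU
      obtain ⟨F, hF, hFU⟩ := near_sub y U hU
      obtain ⟨_, ⟨n, rfl⟩, hn⟩ := h2.2 F hF
      exact ⟨n, fun f hf => hFU f fun x hx => hn hx _ hf.2⟩

theorem sel_countable {X : Type*} [TopologicalSpace X] (h : SelProp X) :
    ∀ 𝒰 : Set (Set X), (∀ U ∈ 𝒰, IsClopen U) → IsOmegaCover 𝒰 →
          ∃ 𝒱 ⊆ 𝒰, 𝒱.Countable ∧ IsOmegaCover 𝒱 := by
  intro 𝒰 hcl hom
  obtain ⟨𝒱, h1, h2⟩ := h 𝒰 hcl hom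
  choose g hg using fun n => (h1 n).2.nonempty
  have hsub : range g ⊆ 𝒰 := by rintro _ ⟨n, rfl⟩; exact (h1 n).1 (hg n)
  refine ⟨range g, hsub, countable_range g, fun hu => hom.1 (hsub hu), fun F hF => ?_⟩
  obtain ⟨_, ⟨n, rfl⟩, hn⟩ := h2.2 F hF
  exact ⟨g n, ⟨n, rfl⟩, fun x hx => hn hx _ (hg n)⟩

def PartProp (X : Type*) [TopologicalSpace X] : Prop :=
  ∀ Ψ : X → ℕ → Bool, Continuous Ψ →
          (∀ x, {n | Ψ x n = true}.Infinite) →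
          ⋂₀ (Set.range fun x => {n | Ψ x n = true}) = ∅ →
          IsCentered (Set.range fun x => {n | Ψ x n = true}) →
          ∃ 𝒬 : ℕ → Set (Set ℕ),
            (⋃ n, 𝒬 n) = FinInterClosure (Set.range fun x => {n | Ψ x n = true}) ∧
            ∀ n, ∃ A, IsPseudoIntersection A (𝒬 n)

theorem sel_part {X : Type*} [TopologicalSpace X] (h : SelProp X) : PartProp X := by
  intro Ψ hΨ _ hfree hcen
  let u : ℕ → Set X := fun n => {x | Ψ x n = true}
  have hne : Nonempty X := by
    by_contra hX
    rw [not_nonempty_iff] at hX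
    rw [range_eq_empty, sInter_empty] at hfree
    exact (univ_nonempty (α := ℕ)).ne_empty hfree
  obtain ⟨x₀⟩ := hne
  obtain ⟨𝒱, h1, h2⟩ := h (range u) (by
      rintro _ ⟨n, rfl⟩
      exact (isClopen_discrete ({true} : Set Bool)).preimage ((continuous_apply n).comp hΨ)) (by
      refine ⟨?_, ?_⟩
      · rintro ⟨n, hn⟩
        have : n ∈ ⋂₀ (Set.range fun x => {n | Ψ x n = true}) := by
          rintro _ ⟨x, rfl⟩
          have : x ∈ u n := hn ▸ mem_univ x
          exact this
        rw [hfree] at this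
        exact this
      · intro F hF
        have := hcen ((fun x => {n | Ψ x n = true}) '' (insert x₀ F)) (image_subset_range _ _)
          ((hF.insert x₀).image _) ((insert_nonempty _ _).image _)
        obtain ⟨n, hn⟩ := this.nonempty
        exact ⟨u n, ⟨n, rfl⟩, fun x hx => hn _ ⟨x, Or.inr hx, rfl⟩⟩)
  refine ⟨fun n => {S ∈ FinInterClosure (Set.range fun x => {n | Ψ x n = true}) | u ⁻¹' 𝒱 n ⊆ S},
    ?_, fun n => ⟨u ⁻¹' 𝒱 n, ?_, ?_⟩⟩
  · apply Subset.antisymm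
    · exact iUnion_subset fun n => sep_subset _ _
    · rintro S hS
      obtain ⟨𝒢, hG, hGf, hGn, rfl⟩ := id hS
      obtain ⟨F, -, hF, hFG⟩ := exists_fin_image _ 𝒢 hG hGf
      obtain ⟨_, ⟨n, rfl⟩, hn⟩ := h2.2 F hF
      refine mem_iUnion.2 ⟨n, hS, ?_⟩
      intro m hm T hT
      rw [← hFG] at hT
      obtain ⟨x, hx, rfl⟩ := hT
      exact hn hx _ hm
  · refine Set.Infinite.of_image u ?_
    rw [image_preimage_eq_of_subset (h1 n).1]
    exact (h1 n).2
  · intro B hB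
    rw [sdiff_eq_empty.2 hB.2]
    exact finite_empty

theorem part_sel {X : Type*} [TopologicalSpace X] (hc : ∀ 𝒰 : Set (Set X),
      (∀ U ∈ 𝒰, IsClopen U) → IsOmegaCover 𝒰 → ∃ 𝒱 ⊆ 𝒰, 𝒱.Countable ∧ IsOmegaCover 𝒱)
    (hp : PartProp X) : SelProp X := by
  classical
  intro 𝒰 hcl hom
  obtain ⟨𝒲, hWU, hWc, hW⟩ := hc 𝒰 hcl hom
  have hWi : 𝒲.Infinite := (omega_inf hW ∅ finite_empty).mono (sep_subset _ _)
  have : Countable 𝒲 := hWc.to_subtype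
  have : Infinite 𝒲 := hWi.to_subtype
  obtain ⟨ε⟩ := nonempty_equiv_of_countable (α := ℕ) (β := 𝒲)
  let u : ℕ → Set X := fun n => (ε n).1
  have hui : Function.Injective u := Subtype.val_injective.comp ε.injective
  have hur : ∀ U ∈ 𝒲, ∃ n, u n = U := fun U hU => ⟨ε.symm ⟨U, hU⟩, by simp [u]⟩
  have huW : ∀ n, u n ∈ 𝒲 := fun n => (ε n).2
  have hinf : ∀ F : Set X, F.Finite → {n | F ⊆ u n}.Infinite := by
    intro F hF
    refine Set.Infinite.of_image u ?_
    refine (omega_inf hW F hF).mono ?_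
    rintro U ⟨hU, hFU⟩
    obtain ⟨n, rfl⟩ := hur U hU
    exact ⟨n, hFU, rfl⟩
  let Ψ : X → ℕ → Bool := fun x n => decide (x ∈ u n)
  have hΨ : ∀ x, {n | Ψ x n = true} = {n | x ∈ u n} := by intro x; simp [Ψ]
  obtain ⟨𝒬, hQ, hA⟩ := hp Ψ (by
      refine continuous_pi fun n => ?_
      have hcn := hcl _ (hWU (huW n))
      refine continuous_discrete_rng.2 fun b => ?_
      cases b
      · have : (fun x => Ψ x n) ⁻¹' {false} = (u n)ᶜ := by ext x; simp [Ψ]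
        rw [this]; exact hcn.compl.isOpen
      · have : (fun x => Ψ x n) ⁻¹' {true} = u n := by ext x; simp [Ψ]
        rw [this]; exact hcn.isOpen)
    (by
      intro x
      rw [hΨ]
      simpa using hinf {x} (finite_singleton x))
    (by
      rw [eq_empty_iff_forall_notMem]
      intro n hn
      apply hW.1
      have : u n = univ := eq_univ_of_forall fun x => by
        have : n ∈ {n | Ψ x n = true} := hn _ ⟨x, rfl⟩
        rwa [hΨ] at this
      rw [← this]; exact huW n)
    (by
      intro 𝒢 hG hGf _
      obtain ⟨F, -, hF, hFG⟩ := exists_fin_image _ 𝒢 hG hGf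
      refine (hinf F hF).mono ?_
      intro n hn T hT
      rw [← hFG] at hT
      obtain ⟨x, hx, rfl⟩ := hT
      simp only [hΨ]
      exact hn hx)
  choose A hAi hAf using hA
  let 𝒱 : ℕ → Set (Set X) := fun p => u '' (A p.unpair.1 ∩ Ici p.unpair.2)
  have hV : ∀ n, 𝒱 n ⊆ 𝒰 ∧ (𝒱 n).Infinite := by
    intro p
    refine ⟨?_, Set.Infinite.image hui.injOn ?_⟩
    · rintro _ ⟨n, _, rfl⟩; exact hWU (huW n)
    · have := (hAi p.unpair.1).sdiff (finite_Iio p.unpair.2)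
      refine this.mono ?_
      rintro n ⟨h1, h2⟩
      exact ⟨h1, by simpa using h2⟩
  refine ⟨𝒱, hV, ?_, ?_⟩
  · rintro ⟨n, hn⟩
    exact sInter_ne_univ hom _ (hV n).1 (hV n).2 hn
  · intro F hF
    rcases F.eq_empty_or_nonempty with rfl | hFn
    · exact ⟨_, ⟨0, rfl⟩, empty_subset _⟩
    have hS : ⋂₀ ((fun x => {n | Ψ x n = true}) '' F) ∈ ⋃ n, 𝒬 n := by
      rw [hQ]
      exact ⟨_, image_subset_range _ _, hF.image _, hFn.image _, rfl⟩
    obtain ⟨n, hn⟩ := mem_iUnion.1 hS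
    obtain ⟨k, hk⟩ := (hAf n _ hn).bddAbove
    refine ⟨_, ⟨Nat.pair n (k + 1), rfl⟩, ?_⟩
    rintro x hx _ ⟨m, hm, rfl⟩
    simp only [Nat.unpair_pair] at hm
    by_contra hxm
    have hle : m ≤ k := hk ⟨hm.1, fun hmem => hxm (by
      have : m ∈ {n | Ψ x n = true} := hmem _ ⟨x, hx, rfl⟩
      rwa [hΨ] at this)⟩
    have := hm.2
    simp only [mem_Ici] at this
    omega

/-- characterizations of the Pytkeev property of `C_p(X,{0,1})`. -/
theorem statement11 (X : Type*) [TopologicalSpace X] :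
    (PytkeevProp (CpS X ({0, 1} : Set ℝ)) ↔
      ((∀ 𝒰 : Set (Set X), (∀ U ∈ 𝒰, IsClopen U) → IsOmegaCover 𝒰 →
          ∃ 𝒱 ⊆ 𝒰, 𝒱.Countable ∧ IsOmegaCover 𝒱) ∧
        ∀ Ψ : X → ℕ → Bool, Continuous Ψ →
          (∀ x, {n | Ψ x n = true}.Infinite) →
          ⋂₀ (Set.range fun x => {n | Ψ x n = true}) = ∅ →
          IsCentered (Set.range fun x => {n | Ψ x n = true}) →
          ∃ 𝒬 : ℕ → Set (Set ℕ),
            (⋃ n, 𝒬 n) = FinInterClosure (Set.range fun x => {n | Ψ x n = true}) ∧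
            ∀ n, ∃ A, IsPseudoIntersection A (𝒬 n))) ∧
    (PytkeevProp (CpS X ({0, 1} : Set ℝ)) ↔
      ∀ 𝒰 : Set (Set X), (∀ U ∈ 𝒰, IsClopen U) → IsOmegaCover 𝒰 →
        ∃ 𝒱 : ℕ → Set (Set X), (∀ n, 𝒱 n ⊆ 𝒰 ∧ (𝒱 n).Infinite) ∧
          IsOmegaCover (Set.range fun n => ⋂₀ 𝒱 n)) := by
  have h13 := pyt_iff_sel X
  refine ⟨h13.trans ⟨fun h => ⟨sel_countable h, sel_part h⟩, fun h => part_sel h.1 h.2⟩, h13⟩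
end

section
/- For every topological space X, C_p(X,{0,1}) has countable tightness if and only if every clopen ω-cover of X contains a countable ω-cover of X. -/
open Set Topology Filter

theorem mem_closure_CpS {X : Type*} [TopologicalSpace X] (A : Set (CpS X ({0, 1} : Set ℝ)))
    (y : CpS X ({0, 1} : Set ℝ)) :
    y ∈ closure A ↔ ∀ F : Set X, F.Finite → ∃ a ∈ A, ∀ x ∈ F, a.1 x = y.1 x := by
  constructor
  · intro h F hF
    rw [mem_closure_iff] at h
    have ho : IsOpen {a : CpS X ({0, 1} : Set ℝ) | ∀ x ∈ F, |a.1 x - y.1 x| < 1} := by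
      have he : {a : CpS X ({0, 1} : Set ℝ) | ∀ x ∈ F, |a.1 x - y.1 x| < 1}
          = ⋂ x ∈ F, {a : CpS X ({0, 1} : Set ℝ) | |a.1 x - y.1 x| < 1} := by
        ext a; simp
      rw [he]
      refine hF.isOpen_biInter fun x _ => ?_
      have hc : Continuous fun a : CpS X ({0, 1} : Set ℝ) => a.1 x :=
        (continuous_apply x).comp continuous_subtype_val
      exact isOpen_lt (hc.sub continuous_const).abs continuous_const
    obtain ⟨a, ha, haA⟩ := h _ ho (by simp)
    refine ⟨a, haA, fun x hx => ?_⟩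
    have h1 := ha x hx
    have h2 := a.2.2 x
    have h3 := y.2.2 x
    simp only [mem_insert_iff, mem_singleton_iff] at h2 h3
    rcases h2 with h2 | h2 <;> rcases h3 with h3 | h3 <;> rw [h2, h3] at h1 ⊢ <;> norm_num at h1
  · intro h
    rw [mem_closure_iff]
    rintro _ ⟨O, hO, rfl⟩ hy
    obtain ⟨I, u, hu, hs⟩ := isOpen_pi_iff.1 hO _ hy
    obtain ⟨a, ha, hax⟩ := h I I.finite_toSet
    refine ⟨a, hs fun x hx => ?_, ha⟩
    rw [hax x hx]
    exact (hu x hx).2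

theorem clopen_agree {X : Type*} [TopologicalSpace X] (a y : CpS X ({0, 1} : Set ℝ)) :
    IsClopen {x | a.1 x = y.1 x} := by
  refine ⟨isClosed_eq a.2.1 y.2.1, ?_⟩
  have he : {x | a.1 x = y.1 x} = {x | |a.1 x - y.1 x| < 1} := by
    ext x
    have h2 := a.2.2 x
    have h3 := y.2.2 x
    simp only [mem_insert_iff, mem_singleton_iff] at h2 h3
    rcases h2 with h2 | h2 <;> rcases h3 with h3 | h3 <;> simp [h2, h3]
  rw [he]
  exact isOpen_lt (a.2.1.sub y.2.1).abs continuous_const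

/-- `C_p(X,{0,1})` has countable tightness iff every clopen
ω-cover of `X` contains a countable ω-cover of `X`. -/
theorem statement12 (X : Type*) [TopologicalSpace X] :
    CountableTightness (CpS X ({0, 1} : Set ℝ)) ↔
      ∀ 𝒰 : Set (Set X), (∀ U ∈ 𝒰, IsClopen U) → IsOmegaCover 𝒰 →
        ∃ 𝒱 ⊆ 𝒰, 𝒱.Countable ∧ IsOmegaCover 𝒱 := by
  classical
  constructor
  · intro ht 𝒰 hcl hU
    let y : CpS X ({0, 1} : Set ℝ) := ⟨fun _ => 1, continuous_const, by simp⟩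
    let A : Set (CpS X ({0, 1} : Set ℝ)) := {a | {x | a.1 x = 1} ∈ 𝒰}
    have hy : y ∈ closure A := by
      rw [mem_closure_CpS]
      intro F hF
      obtain ⟨U, hUU, hFU⟩ := hU.2 F hF
      refine ⟨⟨U.indicator fun _ => 1, ?_, ?_⟩, ?_, ?_⟩
      · exact (hcl U hUU).continuous_indicator continuous_const
      · intro x
        by_cases hx : x ∈ U <;> simp [hx]
      · have he : {x | U.indicator (fun _ => (1 : ℝ)) x = 1} = U := by
          ext x
          by_cases hx : x ∈ U <;> simp [hx]
        change {x | U.indicator (fun _ => (1 : ℝ)) x = 1} ∈ 𝒰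
        rw [he]; exact hUU
      · intro x hx
        simp [y, hFU hx]
    obtain ⟨B, hBA, hBc, hyB⟩ := ht A y hy
    rw [mem_closure_CpS] at hyB
    have hsub : Set.image (fun a : CpS X ({0, 1} : Set ℝ) => {x | a.1 x = 1}) B ⊆ 𝒰 := by
      rintro _ ⟨b, hb, rfl⟩
      exact hBA hb
    refine ⟨_, hsub, hBc.image _, fun h => hU.1 (hsub h), fun F hF => ?_⟩
    obtain ⟨b, hb, hbF⟩ := hyB F hF
    exact ⟨_, ⟨b, hb, rfl⟩, hbF⟩
  · intro h A y hy
    by_cases hyA : y ∈ A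
    · exact ⟨{y}, by simpa using hyA, countable_singleton y, subset_closure rfl⟩
    rw [mem_closure_CpS] at hy
    let f : CpS X ({0, 1} : Set ℝ) → Set X := fun a => {x | a.1 x = y.1 x}
    obtain ⟨𝒱, hV, hVc, hVo⟩ := h (Set.image f A) (by
      rintro _ ⟨a, -, rfl⟩
      exact clopen_agree a y) ⟨by
        rintro ⟨a, ha, hau⟩
        have : a = y := Subtype.ext (funext fun x => by
          have : x ∈ f a := hau ▸ mem_univ x
          exact this)
        exact hyA (this ▸ ha), fun F hF => by
          obtain ⟨a, ha, haF⟩ := hy F hF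
          exact ⟨_, ⟨a, ha, rfl⟩, haF⟩⟩
    obtain ⟨B, hBA, hB⟩ := (SurjOn.exists_bijOn_subset (f := f) (s := A) (t := 𝒱) hV)
    refine ⟨B, hBA, ?_, ?_⟩
    · exact countable_of_injective_of_countable_image hB.injOn (hB.image_eq ▸ hVc)
    · rw [mem_closure_CpS]
      intro F hF
      obtain ⟨U, hUV, hFU⟩ := hVo.2 F hF
      obtain ⟨b, hb, rfl⟩ := hB.surjOn hUV
      exact ⟨b, hb, hFU⟩
end
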